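/- arXiv:1512.04988 — 2 statements merged into one kernel-verified Lean document; each statement's English description precedes it below -/
import Mathlib

section
/- Fix p ∈ (1,∞), let ρ be a Borel probability measure on 𝕊, and let ν be a probability measure on ℝ with m_{p/(p−1)}(ν) < ∞. Suppose that for ρ-almost every θ ∈ 𝕊 the empirical measures L_{n,θ} := (1/n) Σ_{i=1}^n δ_{√n θ_i^{(n)}} converge to ν in the Wasserstein-p/(p−1) sense, i.e., L_{n,θ} converges weakly to ν and m_{p/(p−1)}(L_{n,θ}) → m_{p/(p−1)}(ν) as n → ∞. Then for ρ-almost every θ ∈ 𝕊, the sequence (W_θ^{(n,p)})_{n∈ℕ} satisfies a large deviation principle with speed n and the quasiconvex, symmetric, good rate function 𝕀^q_{p,ν}. -/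
open MeasureTheory Filter Topology Set ProbabilityTheory
open scoped ENNReal NNReal

noncomputable section

namespace LDP

/-- The nonnegative part of an extended real, as an extended nonnegative real. -/
def erealToENNReal (x : EReal) : ℝ≥0∞ := if x = ⊤ then ⊤ else ENNReal.ofReal x.toReal

/-- Extended (possibly infinite) integral of an `EReal`-valued function:
positive part minus negative part. -/
def eIntegral (ν : Measure ℝ) (f : ℝ → EReal) : EReal :=
  ((∫⁻ u, erealToENNReal (f u) ∂ν : ℝ≥0∞) : EReal)
    - ((∫⁻ u, erealToENNReal (-f u) ∂ν : ℝ≥0∞) : EReal)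

/-- `q`-th absolute moment of a measure on `ℝ`. -/
def mom (q : ℝ) (ν : Measure ℝ) : ℝ≥0∞ := ∫⁻ x, ENNReal.ofReal (|x| ^ q) ∂ν

open Classical in
/-- Relative entropy `H(ν|μ)`. -/
def relEnt (ν μ : Measure ℝ) : EReal :=
  if ν ≪ μ then eIntegral ν (fun x => ENNReal.log (ν.rnDeriv μ x)) else ⊤

/-- The generalized normal distribution `μ_p` on `ℝ`. -/
def muP (p : ℝ) : Measure ℝ :=
  volume.withDensity fun y =>
    ENNReal.ofReal ((2 * p ^ (1/p) * Real.Gamma (1 + 1/p))⁻¹ * Real.exp (-(|y| ^ p) / p))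

/-- The uniform probability measure `μ_∞` on `[-1,1]`. -/
def muInf : Measure ℝ := (volume (Icc (-1:ℝ) 1))⁻¹ • volume.restrict (Icc (-1:ℝ) 1)

/-- Extended-real-valued log moment generating function of a measure on `ℝ`. -/
def logM (γ : Measure ℝ) (t : ℝ) : EReal :=
  ENNReal.log (∫⁻ y, ENNReal.ofReal (Real.exp (t * y)) ∂γ)

/-- The class `𝒯_q` of measures whose log mgf is dominated by `C|t|^{q/(q-1)} + C`. -/
def memT (q : ℝ) (γ : Measure ℝ) : Prop :=
  ∃ C : ℝ, ∀ t : ℝ, logM γ t ≤ ((C * |t| ^ (q/(q-1)) + C : ℝ) : EReal)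

/-- Legendre transform of a function of one real variable. -/
def legendre1 (Λ : ℝ → EReal) (τ : ℝ) : EReal := ⨆ t : ℝ, ((t * τ : ℝ) : EReal) - Λ t

/-- Legendre transform of a function of two real variables. -/
def legendre2 (Λ : ℝ × ℝ → EReal) (τ : ℝ × ℝ) : EReal :=
  ⨆ t : ℝ × ℝ, ((t.1 * τ.1 + t.2 * τ.2 : ℝ) : EReal) - Λ t

/-- Legendre transform of a function of three real variables. -/
def legendre3 (Λ : ℝ × ℝ × ℝ → EReal) (τ : ℝ × ℝ × ℝ) : EReal :=
  ⨆ t : ℝ × ℝ × ℝ, ((t.1 * τ.1 + t.2.1 * τ.2.1 + t.2.2 * τ.2.2 : ℝ) : EReal) - Λ t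

/-- `Φ_p(t₀,t₁,t₂) = log ∫∫ exp(t₀ z² + t₁ z y + t₂ |y|^p) μ₂(dz) μ_p(dy)`. -/
def Phi (p : ℝ) (t : ℝ × ℝ × ℝ) : EReal :=
  ENNReal.log (∫⁻ y, (∫⁻ z,
    ENNReal.ofReal (Real.exp (t.1 * z^2 + t.2.1 * z * y + t.2.2 * |y| ^ p)) ∂(muP 2)) ∂(muP p))

/-- The annealed rate function `𝕀ᵃ_p` for `p ∈ [2,∞)`. -/
def Ia (p : ℝ) (w : ℝ) : EReal :=
  ⨅ τ ∈ {τ : ℝ × ℝ × ℝ | 0 < τ.1 ∧ 0 < τ.2.2 ∧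
      τ.1 ^ (-(1:ℝ)/2) * τ.2.1 * τ.2.2 ^ (-(1:ℝ)/p) = w},
    legendre3 (Phi p) τ

/-- `Λ_p(t₁,t₂) = log ∫ exp(t₁ y + t₂|y|^p) μ_p(dy)`. -/
def LamP (p : ℝ) (t : ℝ × ℝ) : EReal :=
  ENNReal.log (∫⁻ y, ENNReal.ofReal (Real.exp (t.1 * y + t.2 * |y| ^ p)) ∂(muP p))

/-- `Ψ_{p,ν}(t₁,t₂) = ∫ Λ_p(t₁ u, t₂) ν(du)`. -/
def Psi (p : ℝ) (ν : Measure ℝ) (t : ℝ × ℝ) : EReal :=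
  eIntegral ν (fun u => LamP p (t.1 * u, t.2))

/-- The quenched rate function `𝕀^q_{p,ν}`. -/
def Iq (p : ℝ) (ν : Measure ℝ) (w : ℝ) : EReal :=
  ⨅ τ ∈ {τ : ℝ × ℝ | 0 < τ.2 ∧ τ.1 * τ.2 ^ (-(1:ℝ)/p) = w}, legendre2 (Psi p ν) τ

/-- The Cramér-type rate function `𝕀^{cr}_p`. -/
def Icr (p : ℝ) (w : ℝ) : EReal :=
  ⨅ τ ∈ {τ : ℝ × ℝ | 0 < τ.2 ∧ τ.1 * τ.2 ^ (-(1:ℝ)/p) = w}, legendre2 (LamP p) τ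

/-- `Φ_γ(t₀,t₁) = log ∫∫ exp(t₀ z² + t₁ z x) μ₂(dz) γ(dx)`. -/
def Phig (γ : Measure ℝ) (t : ℝ × ℝ) : EReal :=
  ENNReal.log (∫⁻ x, (∫⁻ z,
    ENNReal.ofReal (Real.exp (t.1 * z^2 + t.2 * z * x)) ∂(muP 2)) ∂γ)

/-- The annealed rate function `𝕀ᵃ_γ` for a product measure `γ^{⊗n}`. -/
def Iag (γ : Measure ℝ) (w : ℝ) : EReal :=
  ⨅ τ ∈ {τ : ℝ × ℝ | 0 < τ.1 ∧ τ.1 ^ (-(1:ℝ)/2) * τ.2 = w}, legendre2 (Phig γ) τ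

/-- `Ψ_{γ,ν}(t) = ∫ log M_γ(t u) ν(du)`. -/
def Psig (γ ν : Measure ℝ) (t : ℝ) : EReal := eIntegral ν (fun u => logM γ (t * u))

/-- The quenched rate function `𝕀^q_{γ,ν}` for a product measure. -/
def Iqg (γ ν : Measure ℝ) : ℝ → EReal := legendre1 (Psig γ ν)

/-- `Ψ_{∞,ν}`. -/
def PsiInf (ν : Measure ℝ) : ℝ → EReal := Psig muInf ν

/-- `𝕀^q_{∞,ν}`. -/
def IqInf (ν : Measure ℝ) : ℝ → EReal := legendre1 (PsiInf ν)

/-- `𝕀ᵃ_∞`. -/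
def IaInf : ℝ → EReal := Iag muInf

/-- Euclidean inner product on `ℝⁿ`. -/
def dotp {n : ℕ} (x y : Fin n → ℝ) : ℝ := ∑ i, x i * y i

/-- The unit ℓ^p ball of `ℝⁿ`. -/
def lpBall (n : ℕ) (p : ℝ) : Set (Fin n → ℝ) := {x | ∑ i, |x i| ^ p ≤ 1}

/-- The uniform probability measure on the unit ℓ^p ball. -/
def uniformLpBall (n : ℕ) (p : ℝ) : Measure (Fin n → ℝ) :=
  (volume (lpBall n p))⁻¹ • volume.restrict (lpBall n p)

/-- The unit Euclidean sphere in `ℝⁿ`. -/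
def unitSphereSet (n : ℕ) : Set (Fin n → ℝ) := {x | ∑ i, (x i)^2 = 1}

/-- `μ` is the (unique) rotation-invariant probability measure on the unit sphere `S^{n-1}`. -/
def IsUniformSphere {n : ℕ} (μ : Measure (Fin n → ℝ)) : Prop :=
  IsProbabilityMeasure μ ∧ μ (unitSphereSet n) = 1 ∧
    ∀ O : Matrix.orthogonalGroup (Fin n) ℝ,
      Measure.map (fun x => (O : Matrix (Fin n) (Fin n) ℝ).mulVec x) μ = μ

/-- A large deviation principle with speed `s` and rate function `I`. -/
def IsLDP {Ω : Type*} [MeasurableSpace Ω] (P : Measure Ω)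
    (ξ : ℕ → Ω → ℝ) (s : ℕ → ℝ) (I : ℝ → EReal) : Prop :=
  LowerSemicontinuous I ∧
    ∀ Γ : Set ℝ, MeasurableSet Γ →
      (-(⨅ x ∈ interior Γ, I x) ≤
        atTop.liminf fun n =>
          (((s n)⁻¹ : ℝ) : EReal) * ENNReal.log (P {ω | ξ n ω ∈ interior Γ})) ∧
      ((atTop.limsup fun n =>
          (((s n)⁻¹ : ℝ) : EReal) * ENNReal.log (P {ω | ξ n ω ∈ closure Γ})) ≤
        -(⨅ x ∈ closure Γ, I x))

/-- Goodness of a rate function: compact sublevel sets. -/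
def HasCompactSublevels (I : ℝ → EReal) : Prop := ∀ c : ℝ, IsCompact {x | I x ≤ (c : EReal)}

/-- Quasiconvexity: convex sublevel sets. -/
def QuasiconvexRate (I : ℝ → EReal) : Prop := ∀ c : EReal, Convex ℝ {x | I x ≤ c}

/-- Symmetry: `I(-w) = I(w)`. -/
def SymmetricRate (I : ℝ → EReal) : Prop := ∀ w : ℝ, I (-w) = I w

/-- Convexity of an extended-real-valued rate function. -/
def ConvexRate (I : ℝ → EReal) : Prop :=
  ∀ x y a b : ℝ, 0 ≤ a → 0 ≤ b → a + b = 1 →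
    I (a * x + b * y) ≤ (a : EReal) * I x + (b : EReal) * I y

/-- Convexity on a set, for extended-real-valued functions. -/
def ConvexOnE (s : Set ℝ) (g : ℝ → EReal) : Prop :=
  ∀ x ∈ s, ∀ y ∈ s, ∀ a b : ℝ, 0 ≤ a → 0 ≤ b → a + b = 1 →
    g (a * x + b * y) ≤ (a : EReal) * g x + (b : EReal) * g y

/-- Concavity on a set, for extended-real-valued functions. -/
def ConcaveOnE (s : Set ℝ) (g : ℝ → EReal) : Prop :=
  ∀ x ∈ s, ∀ y ∈ s, ∀ a b : ℝ, 0 ≤ a → 0 ≤ b → a + b = 1 →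
    (a : EReal) * g x + (b : EReal) * g y ≤ g (a * x + b * y)

/-- Strict convexity, for extended-real-valued functions. -/
def StrictConvexE (g : ℝ → EReal) : Prop :=
  ∀ x y : ℝ, x ≠ y → ∀ a b : ℝ, 0 < a → 0 < b → a + b = 1 →
    g (a * x + b * y) < (a : EReal) * g x + (b : EReal) * g y

/-- The property of agreeing with a real affine function on a set. -/
def AffineOnE (s : Set ℝ) (g : ℝ → EReal) : Prop :=
  ∃ m q : ℝ, ∀ t ∈ s, g t = ((m * t + q : ℝ) : EReal)

/-- Empirical measure `L_{n,θ} = (1/n) Σ δ_{√n θ_i}`. -/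
def empMeas (n : ℕ) (θn : Fin n → ℝ) : Measure ℝ :=
  ((n : ℝ≥0∞))⁻¹ • ∑ i : Fin n, Measure.dirac (Real.sqrt n * θn i)

end LDP

open LDP

/-- The normalizing constant of the density of `μ_p`. -/
def normC (p : ℝ) : ℝ := 2 * p ^ (1/p) * Real.Gamma (1 + 1/p)

/-- The partition function of the weight `exp (a y - s |y|^p)`. -/
def partFn (p a s : ℝ) : ℝ := ∫ y : ℝ, Real.exp (a * y - s * |y| ^ p)

lemma normC_pos {p : ℝ} (hp : 1 < p) : 0 < normC p := by
  have hp0 : 0 < p := by linarith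
  have := Real.Gamma_pos_of_pos (s := 1 + 1/p) (by positivity)
  unfold normC; positivity

lemma exists_young_bound {p : ℝ} (hp : 1 < p) {ε : ℝ} (hε : 0 < ε) :
    ∃ C : ℝ, 0 ≤ C ∧ ∀ a y : ℝ, a * y ≤ ε * |y| ^ p + C * |a| ^ (p/(p-1)) := by
  have hp0 : 0 < p := by linarith
  have hp1 : 0 < p - 1 := by linarith
  set q := p/(p-1) with hq
  have hq0 : 0 < q := by positivity
  have hpq : p.HolderConjugate q := Real.HolderConjugate.conjExponent hp
  set k := (ε * p) ^ (1/p) with hk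
  have hk0 : 0 < k := by positivity
  have hkp : k ^ p = ε * p := by
    rw [hk, ← Real.rpow_mul (by positivity), one_div_mul_cancel hp0.ne', Real.rpow_one]
  refine ⟨(k ^ q)⁻¹ / q, by positivity, fun a y => ?_⟩
  have h := Real.young_inequality_of_nonneg (a := k * |y|) (b := |a| / k)
    (by positivity) (by positivity) hpq
  rw [Real.mul_rpow hk0.le (abs_nonneg _), hkp, Real.div_rpow (abs_nonneg _) hk0.le] at h
  have h1 : k * |y| * (|a| / k) = |a * y| := by rw [abs_mul]; field_simp
  have h2 : ε * p * |y| ^ p / p = ε * |y| ^ p := by field_simp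
  rw [h1, h2] at h
  calc a * y ≤ |a * y| := le_abs_self _
    _ ≤ _ := h
    _ = _ := by ring

lemma integral_exp_neg_mul_abs_rpow {p s : ℝ} (hp : 0 < p) (hs : 0 < s) :
    ∫ y : ℝ, Real.exp (-s * |y| ^ p) = 2 * (s ^ (-1 / p) * Real.Gamma (1 / p + 1)) := by
  rw [integral_comp_abs (f := fun y => Real.exp (-s * y ^ p)), integral_exp_neg_mul_rpow hp hs]

lemma integrable_exp_neg_mul_abs_rpow {p s : ℝ} (hp : 0 < p) (hs : 0 < s) :
    Integrable (fun y : ℝ => Real.exp (-s * |y| ^ p)) := by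
  refine Integrable.of_integral_ne_zero ?_
  have := Real.Gamma_pos_of_pos (s := 1 / p + 1) (by positivity)
  rw [integral_exp_neg_mul_abs_rpow hp hs]
  positivity

lemma measurable_weight (p a s : ℝ) :
    Measurable fun y : ℝ => Real.exp (a * y - s * |y| ^ p) := by fun_prop

lemma integrable_weight {p : ℝ} (hp : 1 < p) (a : ℝ) {s : ℝ} (hs : 0 < s) :
    Integrable (fun y : ℝ => Real.exp (a * y - s * |y| ^ p)) := by
  obtain ⟨C, -, hC⟩ := exists_young_bound hp (half_pos hs)
  have h := (integrable_exp_neg_mul_abs_rpow (p := p) (by linarith) (half_pos hs)).const_mul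
    (Real.exp (C * |a| ^ (p/(p-1))))
  refine h.mono' (measurable_weight p a s).aestronglyMeasurable (ae_of_all _ fun y => ?_)
  rw [Real.norm_of_nonneg (Real.exp_pos _).le, ← Real.exp_add]
  refine Real.exp_le_exp.2 ?_
  have := hC a y
  linarith

lemma partFn_pos {p : ℝ} (hp : 1 < p) (a : ℝ) {s : ℝ} (hs : 0 < s) : 0 < partFn p a s :=
  integral_exp_pos (integrable_weight hp a hs)

lemma partFn_zero {p : ℝ} (hp : 1 < p) : partFn p 0 (1/p) = normC p := by
  have hp0 : 0 < p := by linarith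
  have h := integral_exp_neg_mul_abs_rpow (p := p) (s := 1/p) hp0 (by positivity)
  unfold partFn normC
  simp only [zero_mul, zero_sub, ← neg_mul]
  rw [h, one_div, Real.inv_rpow hp0.le, ← Real.rpow_neg hp0.le, add_comm]
  ring_nf

lemma partFn_neg (p a s : ℝ) : partFn p (-a) s = partFn p a s := by
  unfold partFn
  rw [← integral_neg_eq_self]
  simp

lemma partFn_scale {p : ℝ} (hp : 1 < p) (a : ℝ) {s : ℝ} (hs : 0 < s) :
    partFn p a s = (p * s) ^ (-1/p) * partFn p (a * (p * s) ^ (-1/p)) (1/p) := by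
  have hp0 : 0 < p := by linarith
  set k := (p * s) ^ (-1/p) with hk
  have hk0 : 0 < k := by positivity
  have hkp : k ^ p = (p * s)⁻¹ := by
    rw [hk, ← Real.rpow_mul (by positivity), div_mul_cancel₀ _ hp0.ne', Real.rpow_neg_one]
  have h := Measure.integral_comp_mul_left (fun y : ℝ => Real.exp (a * y - s * |y| ^ p)) k
  have h2 : partFn p (a * k) (1/p) = ∫ y : ℝ, Real.exp (a * (k * y) - s * |k * y| ^ p) := by
    unfold partFn
    congr 1; ext y
    rw [abs_mul, abs_of_pos hk0, Real.mul_rpow hk0.le (abs_nonneg _), hkp]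
    congr 1
    field_simp
  rw [h2, h, abs_of_pos (by positivity), smul_eq_mul, mul_inv_cancel_left₀ hk0.ne']
  rfl

lemma lintegral_muP {p : ℝ} (hp : 1 < p) (t : ℝ × ℝ) :
    ∫⁻ y, ENNReal.ofReal (Real.exp (t.1 * y + t.2 * |y| ^ p)) ∂(muP p)
      = ∫⁻ y, ENNReal.ofReal
        ((normC p)⁻¹ * Real.exp (t.1 * y - (1/p - t.2) * |y| ^ p)) := by
  have := normC_pos hp
  unfold muP
  rw [lintegral_withDensity_eq_lintegral_mul _ (by fun_prop) (by fun_prop)]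
  congr 1; ext y
  change ENNReal.ofReal ((normC p)⁻¹ * _) * _ = _
  rw [← ENNReal.ofReal_mul (by positivity), mul_assoc, ← Real.exp_add]
  congr 3
  ring

/-- The cumulant generating function of `μ_p`. -/
def cgfP (p : ℝ) : ℝ → ℝ := cgf id (muP p)

lemma integral_exp_muP {p : ℝ} (hp : 1 < p) (t : ℝ) :
    Integrable (fun y => Real.exp (t * y)) (muP p) ∧
      ∫ y, Real.exp (t * y) ∂(muP p) = (normC p)⁻¹ * partFn p t (1/p) := by
  have h0 := normC_pos hp
  have hp0 : 0 < p := by linarith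
  have h := lintegral_muP hp (t, 0)
  simp only [zero_mul, add_zero, sub_zero] at h
  have hi := (integrable_weight hp t (s := 1/p) (by positivity)).const_mul (normC p)⁻¹
  rw [← ofReal_integral_eq_lintegral_ofReal hi (ae_of_all _ fun y => by positivity),
    integral_const_mul] at h
  have hint : Integrable (fun y => Real.exp (t * y)) (muP p) := by
    refine ⟨by fun_prop, ?_⟩
    rw [hasFiniteIntegral_iff_ofReal (ae_of_all _ fun y => (Real.exp_pos _).le), h]
    exact ENNReal.ofReal_lt_top
  refine ⟨hint, ?_⟩
  rw [integral_eq_lintegral_of_nonneg_ae (ae_of_all _ fun y => (Real.exp_pos _).le)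
    (by fun_prop), h, ENNReal.toReal_ofReal]
  · rfl
  · have := (partFn_pos hp t (s := 1/p) (by positivity)).le
    change 0 ≤ _ * partFn p t (1/p)
    positivity

lemma cgfP_eq {p : ℝ} (hp : 1 < p) (t : ℝ) :
    cgfP p t = Real.log ((normC p)⁻¹ * partFn p t (1/p)) := by
  rw [← (integral_exp_muP hp t).2]; rfl

lemma exp_cgfP {p : ℝ} (hp : 1 < p) (t : ℝ) :
    Real.exp (cgfP p t) = (normC p)⁻¹ * partFn p t (1/p) := by
  have := partFn_pos hp t (s := 1/p) (by have : 0 < p := by linarith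
                                         positivity)
  have := normC_pos hp
  rw [cgfP_eq hp, Real.exp_log (by positivity)]

lemma integrableExpSet_muP {p : ℝ} (hp : 1 < p) : integrableExpSet id (muP p) = univ := by
  ext t; simpa [integrableExpSet] using (integral_exp_muP hp t).1

lemma cgfP_neg {p : ℝ} (hp : 1 < p) (t : ℝ) : cgfP p (-t) = cgfP p t := by
  rw [cgfP_eq hp, cgfP_eq hp, partFn_neg]

lemma cgfP_zero {p : ℝ} (hp : 1 < p) : cgfP p 0 = 0 := by
  have := normC_pos hp
  rw [cgfP_eq hp, partFn_zero hp, inv_mul_cancel₀ this.ne', Real.log_one]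

lemma differentiable_cgfP {p : ℝ} (hp : 1 < p) : Differentiable ℝ (cgfP p) := fun t =>
  (analyticAt_cgf (by rw [integrableExpSet_muP hp]; simp)).differentiableAt

lemma differentiable_deriv_cgfP {p : ℝ} (hp : 1 < p) : Differentiable ℝ (deriv (cgfP p)) :=
  fun t => (analyticAt_cgf (X := id) (μ := muP p) (v := t)
    (by rw [integrableExpSet_muP hp]; simp)).deriv.differentiableAt

lemma convexOn_cgfP {p : ℝ} (hp : 1 < p) : ConvexOn ℝ univ (cgfP p) := by
  refine convexOn_univ_of_deriv2_nonneg (differentiable_cgfP hp) (differentiable_deriv_cgfP hp)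
    fun t => ?_
  have h := iteratedDeriv_two_cgf_eq_integral (X := id) (μ := muP p) (v := t)
    (by rw [integrableExpSet_muP hp]; simp)
  rw [← iteratedDeriv_eq_iterate]
  unfold cgfP
  rw [h]
  exact div_nonneg (integral_nonneg fun y => by positivity) mgf_nonneg

lemma cgfP_nonneg {p : ℝ} (hp : 1 < p) (t : ℝ) : 0 ≤ cgfP p t := by
  have h := (convexOn_cgfP hp).2 (mem_univ t) (mem_univ (-t))
    (show (0:ℝ) ≤ 1/2 by norm_num) (show (0:ℝ) ≤ 1/2 by norm_num) (by norm_num)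
  rw [cgfP_neg hp] at h
  simp only [smul_eq_mul] at h
  rw [show 1/2 * t + 1/2 * -t = 0 by ring, cgfP_zero hp] at h
  linarith

lemma exists_cgfP_le {p : ℝ} (hp : 1 < p) :
    ∃ C : ℝ, 0 ≤ C ∧ ∀ t, cgfP p t ≤ C * (1 + |t| ^ (p/(p-1))) := by
  have hp0 : 0 < p := by linarith
  have h0 := normC_pos hp
  obtain ⟨C, hC0, hC⟩ := exists_young_bound hp (ε := 1/(2*p)) (by positivity)
  have hs : (0:ℝ) < 1/(2*p) := by positivity
  set D := Real.log ((normC p)⁻¹ * partFn p 0 (1/(2*p)))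
  have hpp := partFn_pos hp 0 hs
  refine ⟨max C D, le_max_of_le_left hC0, fun t => ?_⟩
  have h1 : partFn p t (1/p) ≤ Real.exp (C * |t| ^ (p/(p-1))) * partFn p 0 (1/(2*p)) := by
    unfold partFn
    rw [← integral_const_mul]
    refine integral_mono (integrable_weight hp t (by positivity))
      ((integrable_weight hp 0 hs).const_mul _) fun y => ?_
    simp only
    rw [← Real.exp_add]
    refine Real.exp_le_exp.2 ?_
    have := hC t y
    have e : 1/p * |y|^p = 1/(2*p) * |y|^p + 1/(2*p) * |y|^p := by field_simp; ring
    linarith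
  have h2 : cgfP p t ≤ C * |t| ^ (p/(p-1)) + D := by
    rw [cgfP_eq hp]
    have := partFn_pos hp t (s := 1/p) (by positivity)
    refine (Real.log_le_log (by positivity)
      (mul_le_mul_of_nonneg_left h1 (by positivity))).trans (le_of_eq ?_)
    rw [mul_left_comm, Real.log_mul (Real.exp_pos _).ne' (by positivity), Real.log_exp]
  have h3 : C * |t| ^ (p/(p-1)) ≤ max C D * |t| ^ (p/(p-1)) :=
    mul_le_mul_of_nonneg_right (le_max_left _ _) (by positivity)
  have h4 := le_max_right C D
  linarith

lemma LamP_eq {p : ℝ} (hp : 1 < p) {t : ℝ × ℝ} (ht : t.2 < 1/p) :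
    LamP p t = ((cgfP p (t.1 * (p * (1/p - t.2)) ^ (-1/p))
      - Real.log (p * (1/p - t.2)) / p : ℝ) : EReal) := by
  have h0 := normC_pos hp
  have hp0 : 0 < p := by linarith
  have hs : 0 < 1/p - t.2 := by linarith
  have hi := (integrable_weight hp t.1 hs).const_mul (normC p)⁻¹
  unfold LamP
  rw [lintegral_muP hp, ← ofReal_integral_eq_lintegral_ofReal hi
    (ae_of_all _ fun y => by positivity), integral_const_mul]
  change ENNReal.log (ENNReal.ofReal (_ * partFn p t.1 (1/p - t.2))) = _
  have h1 := partFn_pos hp t.1 hs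
  have h2 := partFn_pos hp (t.1 * (p * (1/p - t.2)) ^ (-1/p)) (s := 1/p) (by positivity)
  rw [ENNReal.log_ofReal_of_pos (by positivity), cgfP_eq hp, partFn_scale hp t.1 hs,
    mul_left_comm, Real.log_mul (by positivity) (by positivity), Real.log_rpow (by positivity)]
  congr 1
  ring

lemma LamP_eq_top {p : ℝ} (hp : 1 < p) {t : ℝ × ℝ} (ht : 1/p ≤ t.2) : LamP p t = ⊤ := by
  have h0 := normC_pos hp
  unfold LamP
  rw [lintegral_muP hp, ENNReal.log_eq_top_iff]
  have key : ∀ y, 0 ≤ t.1 * y → ENNReal.ofReal (normC p)⁻¹ ≤ ENNReal.ofReal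
      ((normC p)⁻¹ * Real.exp (t.1 * y - (1/p - t.2) * |y| ^ p)) := by
    intro y hy
    refine ENNReal.ofReal_le_ofReal (le_mul_of_one_le_right (by positivity)
      (Real.one_le_exp ?_))
    have : 0 ≤ (t.2 - 1/p) * |y| ^ p := mul_nonneg (by linarith) (by positivity)
    linarith
  have hc : ENNReal.ofReal (normC p)⁻¹ ≠ 0 := by simpa using h0
  have main : ∀ S : Set ℝ, volume S = ⊤ → MeasurableSet S → (∀ y ∈ S, 0 ≤ t.1 * y) →
      ∫⁻ y, ENNReal.ofReal ((normC p)⁻¹ * Real.exp (t.1 * y - (1/p - t.2) * |y| ^ p)) = ⊤ := by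
    intro S hS hm hy
    refine top_le_iff.1 (le_trans ?_ (setLIntegral_le_lintegral S _))
    refine le_trans ?_ (setLIntegral_mono' (f := fun _ => ENNReal.ofReal (normC p)⁻¹) hm
      fun y hyS => key y (hy y hyS))
    rw [setLIntegral_const, hS, ENNReal.mul_top hc]
  rcases le_total 0 t.1 with h | h
  · exact main (Ici 0) Real.volume_Ici measurableSet_Ici fun y hy => mul_nonneg h hy
  · exact main (Iic 0) Real.volume_Iic measurableSet_Iic fun y hy => mul_nonneg_of_nonpos_of_nonpos h hy

lemma ConvexOn.add_deriv_mul_le {f : ℝ → ℝ} (hf : ConvexOn ℝ univ f) (hd : Differentiable ℝ f)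
    (v u : ℝ) : f v + deriv f v * u ≤ f (v + u) := by
  rcases lt_trichotomy u 0 with hu | rfl | hu
  · have h := hf.slope_le_deriv (mem_univ (v + u)) (mem_univ v) (by linarith) (hd v)
    rw [slope_def_field, show v - (v + u) = -u by ring, div_le_iff₀ (by linarith)] at h
    linarith
  · simp
  · have h := hf.deriv_le_slope (mem_univ v) (mem_univ (v + u)) (by linarith) (hd v)
    rw [slope_def_field, add_sub_cancel_left, le_div_iff₀ hu] at h
    linarith

lemma abs_mul_deriv_cgfP_le {p : ℝ} (hp : 1 < p) :
    ∃ C : ℝ, 0 ≤ C ∧ ∀ t u : ℝ,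
      |u * deriv (cgfP p) (t * u)| ≤ C * (1 + (|t| + 1) ^ (p/(p-1)) * |u| ^ (p/(p-1))) := by
  obtain ⟨C, hC0, hC⟩ := exists_cgfP_le hp
  have hq : 0 ≤ p/(p-1) := div_nonneg (by linarith) (by linarith)
  refine ⟨C, hC0, fun t u => ?_⟩
  have key : ∀ σ : ℝ, |σ| ≤ 1 →
      cgfP p (t * u + σ * u) ≤ C * (1 + (|t| + 1) ^ (p/(p-1)) * |u| ^ (p/(p-1))) := by
    intro σ hσ
    refine (hC _).trans (mul_le_mul_of_nonneg_left ?_ hC0)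
    rw [← Real.mul_rpow (by positivity) (abs_nonneg _), ← add_mul, abs_mul]
    have h : |t + σ| * |u| ≤ (|t| + 1) * |u| :=
      mul_le_mul_of_nonneg_right ((abs_add_le _ _).trans (by linarith)) (abs_nonneg _)
    have := Real.rpow_le_rpow (by positivity) h hq
    linarith
  have h1 := ConvexOn.add_deriv_mul_le (convexOn_cgfP hp) (differentiable_cgfP hp) (t * u) (1 * u)
  have h2 := ConvexOn.add_deriv_mul_le (convexOn_cgfP hp) (differentiable_cgfP hp) (t * u) (-1 * u)
  have h3 := key 1 (by simp)
  have h4 := key (-1) (by simp)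
  have h5 := cgfP_nonneg hp (t * u)
  rw [abs_le]
  constructor <;> linarith

lemma integrable_abs_rpow_of_mom {q : ℝ} {ν : Measure ℝ} (hν : mom q ν ≠ ⊤) :
    Integrable (fun u : ℝ => |u| ^ q) ν := by
  refine ⟨(measurable_id.abs.pow_const q).aestronglyMeasurable, ?_⟩
  rw [hasFiniteIntegral_iff_ofReal (ae_of_all _ fun y => by positivity)]
  exact hν.lt_top

/-- The averaged cumulant generating function `∫ log E exp (t u Y) ν(du)`, `Y ∼ μ_p`. -/
def phiP (p : ℝ) (ν : Measure ℝ) (t : ℝ) : ℝ := ∫ u, cgfP p (t * u) ∂ν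

lemma continuous_cgfP {p : ℝ} (hp : 1 < p) : Continuous (cgfP p) :=
  (differentiable_cgfP hp).continuous

lemma exists_cgfP_mul_le {p : ℝ} (hp : 1 < p) (t : ℝ) :
    ∃ C : ℝ, 0 ≤ C ∧ ∀ u, cgfP p (t * u) ≤ C * (1 + |u| ^ (p/(p-1))) := by
  obtain ⟨C, hC0, hC⟩ := exists_cgfP_le hp
  refine ⟨C * (1 + |t| ^ (p/(p-1))), by positivity, fun u => (hC _).trans ?_⟩
  rw [abs_mul, Real.mul_rpow (abs_nonneg _) (abs_nonneg _), mul_assoc]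
  refine mul_le_mul_of_nonneg_left ?_ hC0
  have h1 : 0 ≤ |t| ^ (p/(p-1)) := by positivity
  have h2 : 0 ≤ |u| ^ (p/(p-1)) := by positivity
  nlinarith

lemma integrable_cgfP_mul {p : ℝ} (hp : 1 < p) {ν : Measure ℝ} [IsProbabilityMeasure ν]
    (hν : mom (p/(p-1)) ν ≠ ⊤) (t : ℝ) : Integrable (fun u => cgfP p (t * u)) ν := by
  obtain ⟨C, hC0, hC⟩ := exists_cgfP_mul_le hp t
  have h := ((integrable_const (1:ℝ)).add (integrable_abs_rpow_of_mom hν)).const_mul C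
  refine h.mono' ((continuous_cgfP hp).comp (by fun_prop)).aestronglyMeasurable
    (ae_of_all _ fun u => ?_)
  rw [Real.norm_of_nonneg (cgfP_nonneg hp _)]
  exact hC u

lemma phiP_nonneg {p : ℝ} (hp : 1 < p) (ν : Measure ℝ) (t : ℝ) : 0 ≤ phiP p ν t :=
  integral_nonneg fun u => cgfP_nonneg hp (t * u)

lemma phiP_neg {p : ℝ} (hp : 1 < p) (ν : Measure ℝ) (t : ℝ) : phiP p ν (-t) = phiP p ν t := by
  simp only [phiP, neg_mul, cgfP_neg hp]

lemma phiP_zero {p : ℝ} (hp : 1 < p) (ν : Measure ℝ) : phiP p ν 0 = 0 := by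
  simp [phiP, cgfP_zero hp]

lemma differentiable_phiP {p : ℝ} (hp : 1 < p) {ν : Measure ℝ} [IsProbabilityMeasure ν]
    (hν : mom (p/(p-1)) ν ≠ ⊤) : Differentiable ℝ (phiP p ν) := by
  intro t
  obtain ⟨C, hC0, hC⟩ := abs_mul_deriv_cgfP_le hp
  have hq : 0 ≤ p/(p-1) := div_nonneg (by linarith) (by linarith)
  have hb := ((integrable_const (1:ℝ)).add ((integrable_abs_rpow_of_mom hν).const_mul
    ((|t| + 1 + 1) ^ (p/(p-1))))).const_mul C
  refine (hasDerivAt_integral_of_dominated_loc_of_deriv_le (F := fun t u => cgfP p (t * u))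
    (F' := fun t u => u * deriv (cgfP p) (t * u))
    (Metric.ball_mem_nhds t one_pos) (Eventually.of_forall fun x =>
      ((continuous_cgfP hp).comp (by fun_prop)).aestronglyMeasurable)
    (integrable_cgfP_mul hp hν t) ?_ (ae_of_all _ fun u x hx => ?_) hb
    (ae_of_all _ fun u x _ => ?_)).2.differentiableAt
  · exact ((continuous_id.mul ((differentiable_deriv_cgfP hp).continuous.comp
      (by fun_prop))).aestronglyMeasurable)
  · refine (hC x u).trans (mul_le_mul_of_nonneg_left ?_ hC0)
    have h1 : |x| ≤ |t| + 1 := by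
      have := abs_sub_abs_le_abs_sub x t
      rw [Metric.mem_ball, Real.dist_eq] at hx
      linarith
    have h2 : (|x| + 1) ^ (p/(p-1)) ≤ (|t| + 1 + 1) ^ (p/(p-1)) :=
      Real.rpow_le_rpow (by positivity) (by linarith) hq
    have := mul_le_mul_of_nonneg_right h2 (show 0 ≤ |u| ^ (p/(p-1)) by positivity)
    simpa using this
  · have h := ((differentiable_cgfP hp (x * u)).hasDerivAt.comp x
      ((hasDerivAt_id x).mul_const u))
    simpa [mul_comm, Function.comp_def] using h

/-- The real-valued form of `Ψ_{p,ν}(a, 1/p - s)` for `s > 0`. -/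
def psiR (p : ℝ) (ν : Measure ℝ) (a s : ℝ) : ℝ :=
  phiP p ν (a * (p * s) ^ (-1/p)) - Real.log (p * s) / p

lemma psiR_neg {p : ℝ} (hp : 1 < p) (ν : Measure ℝ) (a s : ℝ) :
    psiR p ν (-a) s = psiR p ν a s := by
  rw [psiR, neg_mul, phiP_neg hp, psiR]

lemma neg_log_le_psiR {p : ℝ} (hp : 1 < p) (ν : Measure ℝ) (a s : ℝ) :
    -(Real.log (p * s) / p) ≤ psiR p ν a s := by
  have := phiP_nonneg hp ν (a * (p * s) ^ (-1/p))
  unfold psiR; linarith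

lemma psiR_zero {p : ℝ} (hp : 1 < p) (ν : Measure ℝ) : psiR p ν 0 (1/p) = 0 := by
  rw [psiR, zero_mul, phiP_zero hp, mul_one_div_cancel (by linarith)]; simp

lemma differentiable_psiR_left {p : ℝ} (hp : 1 < p) {ν : Measure ℝ} [IsProbabilityMeasure ν]
    (hν : mom (p/(p-1)) ν ≠ ⊤) (s : ℝ) : Differentiable ℝ fun a => psiR p ν a s := by
  have := differentiable_phiP hp hν
  unfold psiR
  fun_prop

lemma differentiableAt_psiR_right {p : ℝ} (hp : 1 < p) {ν : Measure ℝ} [IsProbabilityMeasure ν]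
    (hν : mom (p/(p-1)) ν ≠ ⊤) (a : ℝ) {s : ℝ} (hs : 0 < s) :
    DifferentiableAt ℝ (fun s => psiR p ν a s) s := by
  have hps : p * s ≠ 0 := by positivity
  unfold psiR
  have h1 : DifferentiableAt ℝ (fun s => p * s) s := by fun_prop
  exact ((differentiable_phiP hp hν _).fun_comp' s
    ((h1.rpow_const (Or.inl hps)).const_mul a)).sub ((h1.log hps).div_const p)

lemma continuousOn_psiR {p : ℝ} (hp : 1 < p) {ν : Measure ℝ} [IsProbabilityMeasure ν]
    (hν : mom (p/(p-1)) ν ≠ ⊤) :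
    ContinuousOn (fun x : ℝ × ℝ => psiR p ν x.1 x.2) {x | 0 < x.2} := by
  intro x hx
  have hps : p * x.2 ≠ 0 := by have : 0 < x.2 := hx
                               positivity
  have h1 : ContinuousAt (fun x : ℝ × ℝ => p * x.2) x := by fun_prop
  refine ContinuousAt.continuousWithinAt ?_
  unfold psiR
  exact ((differentiable_phiP hp hν).continuous.continuousAt.comp
    (continuousAt_fst.mul (h1.rpow_const (Or.inl hps)))).sub ((h1.log hps).div_const p)

lemma eIntegral_coe {ν : Measure ℝ} {f : ℝ → ℝ} (hf : Integrable f ν) :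
    eIntegral ν (fun u => (f u : EReal)) = ((∫ u, f u ∂ν : ℝ) : EReal) := by
  have h1 : ∀ x : ℝ, erealToENNReal (x : EReal) = ENNReal.ofReal x := fun x => by
    simp [erealToENNReal]
  have h2 : ∀ x : ℝ, erealToENNReal (-(x : EReal)) = ENNReal.ofReal (-x) := fun x => by
    rw [← EReal.coe_neg, h1]
  have e1 : ∫⁻ u, ENNReal.ofReal (f u) ∂ν ≠ ⊤ :=
    ((lintegral_ofReal_le_lintegral_enorm f).trans_lt hf.2).ne
  have e2 : ∫⁻ u, ENNReal.ofReal (-f u) ∂ν ≠ ⊤ :=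
    ((lintegral_ofReal_le_lintegral_enorm (-f)).trans_lt hf.neg.2).ne
  unfold eIntegral
  simp only [h1, h2]
  rw [integral_eq_lintegral_pos_part_sub_lintegral_neg_part hf, EReal.coe_sub,
    EReal.coe_ennreal_toReal e1, EReal.coe_ennreal_toReal e2]

lemma Psi_eq {p : ℝ} (hp : 1 < p) {ν : Measure ℝ} [IsProbabilityMeasure ν]
    (hν : mom (p/(p-1)) ν ≠ ⊤) {t : ℝ × ℝ} (ht : t.2 < 1/p) :
    Psi p ν t = ((psiR p ν t.1 (1/p - t.2) : ℝ) : EReal) := by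
  have h1 : ∀ u : ℝ, LamP p (t.1 * u, t.2) = ((cgfP p ((t.1 * (p * (1/p - t.2)) ^ (-1/p)) * u)
      - Real.log (p * (1/p - t.2)) / p : ℝ) : EReal) := fun u => by
    rw [LamP_eq hp (t := (t.1 * u, t.2)) ht]
    ring_nf
  have hi := integrable_cgfP_mul hp hν (t.1 * (p * (1/p - t.2)) ^ (-1/p))
  unfold Psi
  simp only [h1]
  rw [eIntegral_coe (f := fun u => cgfP p ((t.1 * (p * (1/p - t.2)) ^ (-1/p)) * u)
    - Real.log (p * (1/p - t.2)) / p) (hi.sub (integrable_const _)), integral_sub hi (integrable_const _)]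
  simp [psiR, phiP]

lemma Psi_eq_top {p : ℝ} (hp : 1 < p) {ν : Measure ℝ} [IsProbabilityMeasure ν]
    {t : ℝ × ℝ} (ht : 1/p ≤ t.2) : Psi p ν t = ⊤ := by
  have h1 : ∀ u : ℝ, LamP p (t.1 * u, t.2) = ⊤ := fun u => LamP_eq_top hp ht
  unfold Psi eIntegral
  simp [h1, erealToENNReal]

lemma legendre2_Psi_le_iff {p : ℝ} (hp : 1 < p) {ν : Measure ℝ} [IsProbabilityMeasure ν]
    (hν : mom (p/(p-1)) ν ≠ ⊤) {τ : ℝ × ℝ} {c : EReal} :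
    legendre2 (Psi p ν) τ ≤ c ↔ ∀ a s : ℝ, 0 < s →
      ((a * τ.1 + (1/p - s) * τ.2 - psiR p ν a s : ℝ) : EReal) ≤ c := by
  unfold legendre2
  rw [iSup_le_iff]
  constructor
  · intro h a s hs
    have := h (a, 1/p - s)
    rw [Psi_eq hp hν (by simpa using hs), ← EReal.coe_sub] at this
    simpa using this
  · intro h t
    rcases lt_or_ge t.2 (1/p) with ht | ht
    · have := h t.1 (1/p - t.2) (by linarith)
      rw [Psi_eq hp hν ht, ← EReal.coe_sub]
      simpa using this
    · rw [Psi_eq_top hp ht]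
      simp

lemma Iq_le_iff {p : ℝ} (hp : 1 < p) {ν : Measure ℝ} [IsProbabilityMeasure ν]
    (hν : mom (p/(p-1)) ν ≠ ⊤) {w : ℝ} {c : EReal} :
    Iq p ν w ≤ c ↔ ∀ a s : ℝ, 0 < s → ((a * w + 1/p - s - psiR p ν a s : ℝ) : EReal) ≤ c := by
  have hp0 : 0 < p := by linarith
  constructor
  · intro h a s hs
    refine le_trans ?_ h
    unfold Iq
    refine le_iInf₂ fun τ hτ => ?_
    obtain ⟨hτ0, hτw⟩ := hτ
    have h1 := (legendre2_Psi_le_iff hp hν (τ := τ)).1 le_rfl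
      (a * τ.2 ^ (-1/p)) (s / τ.2) (by positivity)
    refine le_trans (EReal.coe_le_coe_iff.2 ?_) h1
    have e1 : psiR p ν (a * τ.2 ^ (-1/p)) (s / τ.2) = psiR p ν a s + Real.log τ.2 / p := by
      unfold psiR
      rw [← mul_div_assoc, Real.div_rpow (by positivity) hτ0.le, Real.log_div (by positivity)
        hτ0.ne', mul_assoc, mul_div_cancel₀ _ (by positivity)]
      ring
    have e2 : a * τ.2 ^ (-1/p) * τ.1 = a * w := by
      rw [← hτw]; ring
    have e3 : (1/p - s / τ.2) * τ.2 = τ.2 / p - s := by field_simp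
    have e4 := div_le_div_of_nonneg_right (Real.log_le_sub_one_of_pos hτ0) hp0.le
    rw [e1, e2, e3]
    rw [sub_div] at e4
    linarith
  · intro h
    have h1 : Iq p ν w ≤ legendre2 (Psi p ν) (w, 1) :=
      iInf₂_le (w, 1) ⟨by simp, by simp⟩
    refine h1.trans ((legendre2_Psi_le_iff hp hν).2 fun a s hs => ?_)
    convert h a s hs using 2
    ring

lemma le_Iq {p : ℝ} (hp : 1 < p) {ν : Measure ℝ} [IsProbabilityMeasure ν]
    (hν : mom (p/(p-1)) ν ≠ ⊤) (w a : ℝ) {s : ℝ} (hs : 0 < s) :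
    ((a * w + 1/p - s - psiR p ν a s : ℝ) : EReal) ≤ Iq p ν w :=
  (Iq_le_iff hp hν).1 le_rfl a s hs

lemma Iq_nonneg {p : ℝ} (hp : 1 < p) {ν : Measure ℝ} [IsProbabilityMeasure ν]
    (hν : mom (p/(p-1)) ν ≠ ⊤) (w : ℝ) : 0 ≤ Iq p ν w := by
  have := le_Iq hp hν w 0 (s := 1/p) (by have : 0 < p := by linarith
                                         positivity)
  simpa [psiR_zero hp, ← one_div] using this

lemma Iq_neg {p : ℝ} (hp : 1 < p) {ν : Measure ℝ} [IsProbabilityMeasure ν]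
    (hν : mom (p/(p-1)) ν ≠ ⊤) (w : ℝ) : Iq p ν (-w) = Iq p ν w := by
  have key : ∀ w, Iq p ν (-w) ≤ Iq p ν w := fun w => by
    refine (Iq_le_iff hp hν).2 fun a s hs => ?_
    have := le_Iq hp hν w (-a) hs
    rw [psiR_neg hp] at this
    convert this using 4
    ring
  exact (key w).antisymm (by simpa using key (-w))

lemma setOf_Iq_le {p : ℝ} (hp : 1 < p) {ν : Measure ℝ} [IsProbabilityMeasure ν]
    (hν : mom (p/(p-1)) ν ≠ ⊤) (c : EReal) :
    {w | Iq p ν w ≤ c} = ⋂ (a : ℝ) (s : ℝ) (_ : 0 < s),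
      {w : ℝ | ((a * w + 1/p - s - psiR p ν a s : ℝ) : EReal) ≤ c} := by
  ext w; simp only [mem_ofPred_eq, mem_iInter, Iq_le_iff hp hν]

lemma lowerSemicontinuous_Iq {p : ℝ} (hp : 1 < p) {ν : Measure ℝ} [IsProbabilityMeasure ν]
    (hν : mom (p/(p-1)) ν ≠ ⊤) : LowerSemicontinuous (Iq p ν) := by
  rw [lowerSemicontinuous_iff_isClosed_preimage]
  intro c
  change IsClosed {w | Iq p ν w ≤ c}
  rw [setOf_Iq_le hp hν]
  refine isClosed_iInter fun a => isClosed_iInter fun s => isClosed_iInter fun _ => ?_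
  exact isClosed_le (continuous_coe_real_ereal.comp (by fun_prop)) continuous_const

lemma quasiconvexRate_Iq {p : ℝ} (hp : 1 < p) {ν : Measure ℝ} [IsProbabilityMeasure ν]
    (hν : mom (p/(p-1)) ν ≠ ⊤) : QuasiconvexRate (Iq p ν) := by
  intro c
  rw [setOf_Iq_le hp hν]
  refine convex_iInter fun a => convex_iInter fun s => convex_iInter fun _ => ?_
  intro x hx y hy α β hα hβ hαβ
  simp only [mem_ofPred_eq] at *
  have e : a * (α • x + β • y) = α * (a * x) + β * (a * y) := by
    simp only [smul_eq_mul]; ring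
  rcases le_total (a * x) (a * y) with h | h
  · refine le_trans (EReal.coe_le_coe_iff.2 ?_) hy
    have h1 := mul_le_mul_of_nonneg_left h hα
    have h2 : (α + β) * (a * y) = a * y := by rw [hαβ, one_mul]
    linarith
  · refine le_trans (EReal.coe_le_coe_iff.2 ?_) hx
    have h1 := mul_le_mul_of_nonneg_left h hβ
    have h2 : (α + β) * (a * x) = a * x := by rw [hαβ, one_mul]
    linarith

lemma hasCompactSublevels_Iq {p : ℝ} (hp : 1 < p) {ν : Measure ℝ} [IsProbabilityMeasure ν]
    (hν : mom (p/(p-1)) ν ≠ ⊤) : HasCompactSublevels (Iq p ν) := by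
  intro c
  have hp0 : 0 < p := by linarith
  have hcl : IsClosed {x | Iq p ν x ≤ (c : EReal)} :=
    lowerSemicontinuous_iff_isClosed_preimage.1 (lowerSemicontinuous_Iq hp hν) c
  set K := c + psiR p ν 1 (1/p) with hK
  refine Metric.isCompact_of_isClosed_isBounded hcl
    ((Metric.isBounded_Icc (-K) K).subset fun w hw => ?_)
  have h1 := EReal.coe_le_coe_iff.1 ((le_Iq hp hν w 1 (s := 1/p) (by positivity)).trans hw)
  have h2 := EReal.coe_le_coe_iff.1 ((le_Iq hp hν w (-1) (s := 1/p) (by positivity)).trans hw)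
  rw [psiR_neg hp] at h2
  constructor <;> linarith

lemma neg_add_log_div_le {p s : ℝ} (hp : 1 < p) (hs : 0 < s) :
    -s + Real.log (p * s) / p ≤ -(1/p) := by
  have hp0 : 0 < p := by linarith
  have := div_le_div_of_nonneg_right
    (Real.log_le_sub_one_of_pos (show 0 < p * s by positivity)) hp0.le
  rw [sub_div, mul_div_cancel_left₀ _ hp0.ne'] at this
  linarith

lemma isMax_zero {p : ℝ} (hp : 1 < p) (ν : Measure ℝ) (a s : ℝ) (hs : 0 < s) :
    a * 0 - s - psiR p ν a s ≤ 0 * 0 - 1/p - psiR p ν 0 (1/p) := by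
  have h1 := neg_log_le_psiR hp ν a s
  have h2 := neg_add_log_div_le hp hs
  rw [psiR_zero hp]
  linarith

/-- The supremum defining the rate function is attained at points of the interior of the
effective domain. -/
lemma exists_maximizer {p : ℝ} (hp : 1 < p) {ν : Measure ℝ} [IsProbabilityMeasure ν]
    (hν : mom (p/(p-1)) ν ≠ ⊤) {x : ℝ} (hx : Iq p ν x ≠ ⊤) {l : ℝ} (hl0 : 0 ≤ l) (hl1 : l < 1) :
    ∃ a s : ℝ, 0 < s ∧ ∀ a' s' : ℝ, 0 < s' →
      a' * (l * x) - s' - psiR p ν a' s' ≤ a * (l * x) - s - psiR p ν a s := by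
  have hp0 : 0 < p := by linarith
  rcases eq_or_ne x 0 with rfl | hx0
  · refine ⟨0, 1/p, by positivity, fun a' s' hs' => ?_⟩
    simpa using isMax_zero hp ν a' s' hs'
  set K := (Iq p ν x).toReal
  have hK : ∀ a s : ℝ, 0 < s → |a| * |x| + 1/p - s - psiR p ν a s ≤ K := by
    have h0 : ∀ a s : ℝ, 0 < s → a * x + 1/p - s - psiR p ν a s ≤ K := fun a s hs =>
      EReal.coe_le_coe_iff.1 ((le_Iq hp hν x a hs).trans (EReal.le_coe_toReal hx))
    intro a s hs
    rw [← abs_mul]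
    rcases abs_choice (a * x) with h | h
    · rw [h]; exact h0 a s hs
    · have := h0 (-a) s hs
      rw [psiR_neg hp] at this
      rw [h]; linarith
  set F : ℝ × ℝ → ℝ := fun y => y.1 * (l * x) - y.2 - psiR p ν y.1 y.2 with hF
  have hxa : 0 < |x| := abs_pos.2 hx0
  have hle : ∀ a : ℝ, a * (l * x) ≤ l * (|a| * |x|) := fun a => by
    refine (le_abs_self _).trans (le_of_eq ?_)
    rw [abs_mul, abs_mul, abs_of_nonneg hl0]; ring
  set R := K / ((1 - l) * |x|) with hR
  have hboundA : ∀ a s : ℝ, 0 < s → -(1/p) ≤ F (a, s) → |a| ≤ R := by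
    intro a s hs h
    rw [hR, le_div_iff₀ (mul_pos (by linarith) hxa)]
    have h1 := hK a s hs
    have h2 := hle a
    simp only [hF] at h
    have h3 := (neg_log_le_psiR hp ν a s)
    nlinarith
  set M := R * (l * |x|) + 1/p + Real.log 2 / p with hM
  have hFle : ∀ a s : ℝ, 0 < s → |a| ≤ R → F (a, s) ≤ R * (l * |x|) - s + Real.log (p * s) / p := by
    intro a s hs h
    have h1 := hle a
    have h2 := neg_log_le_psiR hp ν a s
    have h3 := mul_le_mul_of_nonneg_right h (show 0 ≤ l * |x| by positivity)
    simp only [hF]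
    linarith
  have hbound : ∀ a s : ℝ, 0 < s → -(1/p) ≤ F (a, s) →
      s ∈ Icc (Real.exp (-(M * p)) / p) (2 * M) := by
    intro a s hs h
    have hps : 0 < p * s := by positivity
    have h1 := h.trans (hFle a s hs (hboundA a s hs h))
    have hlog2 : 0 ≤ Real.log 2 / p := div_nonneg (Real.log_nonneg one_le_two) hp0.le
    constructor
    · have h2 : -M ≤ Real.log (p * s) / p := by linarith
      rw [le_div_iff₀ hp0, Real.le_log_iff_exp_le hps, neg_mul] at h2
      rw [div_le_iff₀ hp0]; linarith
    · have h2 := div_le_div_of_nonneg_right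
        (Real.log_le_sub_one_of_pos (show 0 < p * s / 2 by positivity)) hp0.le
      rw [Real.log_div hps.ne' two_ne_zero, sub_div, sub_div] at h2
      have h3 : p * s / 2 / p = s / 2 := by field_simp
      have h4 : 0 < 1 / p := by positivity
      linarith
  set T := Icc (-R) R ×ˢ Icc (Real.exp (-(M * p)) / p) (2 * M) with hT
  have hTpos : ∀ y ∈ T, 0 < y.2 := fun y hy =>
    (show 0 < Real.exp (-(M * p)) / p by positivity).trans_le hy.2.1
  have hF0 : F (0, 1/p) = -(1/p) := by simp only [hF, psiR_zero hp]; ring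
  have hmem : ∀ a s : ℝ, 0 < s → -(1/p) ≤ F (a, s) → (a, s) ∈ T := fun a s hs h =>
    ⟨abs_le.1 (hboundA a s hs h), hbound a s hs h⟩
  have hmem0 : (0, 1/p) ∈ T := hmem 0 (1/p) (by positivity) hF0.ge
  have hcont : ContinuousOn F T := by
    have h1 : ContinuousOn (fun y : ℝ × ℝ => y.1 * (l * x) - y.2) T := by fun_prop
    exact h1.sub ((continuousOn_psiR hp hν).mono fun y hy => hTpos y hy)
  obtain ⟨y, hyT, hy⟩ := (isCompact_Icc.prod isCompact_Icc).exists_isMaxOn ⟨_, hmem0⟩ hcont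
  refine ⟨y.1, y.2, hTpos y hyT, fun a' s' hs' => ?_⟩
  have h0 : -(1/p) ≤ F y := hF0.ge.trans (hy hmem0)
  rcases le_or_gt (-(1/p)) (F (a', s')) with h | h
  · exact hy (hmem a' s' hs' h)
  · exact h.le.trans h0

/-- At a point where `f` dominates its affine minorant of slope `m` and is differentiable, its
increments are of first order `m`. -/
lemma eventually_sub_lt {f : ℝ → ℝ} {x m : ℝ} (hf : DifferentiableAt ℝ f x)
    (hm : ∀ᶠ y in 𝓝 x, f x + m * (y - x) ≤ f y) {η : ℝ} (hη : 0 < η) :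
    ∀ᶠ h in 𝓝[>] (0:ℝ), f (x + h) - f x - m * h < η * h ∧ f (x - h) - f x + m * h < η * h := by
  have hd : HasDerivAt (fun y => f y - m * (y - x)) (deriv f x - m) x := by
    have h1 : HasDerivAt (fun y => m * (y - x)) (m * 1) x :=
      ((hasDerivAt_id x).sub_const x).const_mul m
    rw [mul_one] at h1
    exact hf.hasDerivAt.fun_sub h1
  have hmin : IsLocalMin (fun y => f y - m * (y - x)) x := by
    filter_upwards [hm] with y hy
    simp only [sub_self, mul_zero, sub_zero]
    linarith
  have h0 : deriv f x - m = 0 := hmin.hasDerivAt_eq_zero hd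
  have hf' : HasDerivAt f m x := by rw [← sub_eq_zero.1 h0]; exact hf.hasDerivAt
  have hlo := (hasDerivAt_iff_isLittleO_nhds_zero.1 hf').bound (half_pos hη)
  have hneg : Tendsto (fun h : ℝ => -h) (𝓝[>] 0) (𝓝 0) := by
    have : Tendsto (fun h : ℝ => -h) (𝓝 0) (𝓝 (-0)) := tendsto_id.neg
    rw [neg_zero] at this
    exact this.mono_left nhdsWithin_le_nhds
  filter_upwards [nhdsWithin_le_nhds hlo, hneg.eventually hlo, self_mem_nhdsWithin] with h h1 h2 h3
  have h3 : 0 < h := h3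
  rw [norm_neg] at h2
  rw [Real.norm_of_nonneg h3.le, Real.norm_eq_abs] at h1 h2
  have h4 := le_abs_self (f (x + h) - f x - h • m)
  have h5 := le_abs_self (f (x + -h) - f x - (-h) • m)
  rw [← sub_eq_add_neg] at h2 h5
  simp only [smul_eq_mul] at *
  have h6 : η / 2 * h < η * h := by nlinarith
  constructor <;> linarith

/-- Exponential tightness of the tilted laws around a maximizer: strict inequalities between
shifted values of the limiting log-partition function. -/
lemma exists_tilt {p : ℝ} (hp : 1 < p) {ν : Measure ℝ} [IsProbabilityMeasure ν]
    (hν : mom (p/(p-1)) ν ≠ ⊤) {w a s : ℝ} (hs : 0 < s)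
    (hmax : ∀ a' s' : ℝ, 0 < s' → a' * w - s' - psiR p ν a' s' ≤ a * w - s - psiR p ν a s)
    {η : ℝ} (hη : 0 < η) :
    ∃ h : ℝ, 0 < h ∧ h < s ∧
      psiR p ν (a + h) s - h * (w + η) < psiR p ν a s ∧
      psiR p ν (a - h) s + h * (w - η) < psiR p ν a s ∧
      psiR p ν a (s - h) - h * (1 + η) < psiR p ν a s ∧
      psiR p ν a (s + h) + h * (1 - η) < psiR p ν a s := by
  have h1 := eventually_sub_lt (differentiable_psiR_left hp hν s a) (m := w)
    (Eventually.of_forall fun y => by have := hmax y s hs; linarith) hη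
  have h2 := eventually_sub_lt (differentiableAt_psiR_right hp hν a hs) (m := -1)
    (by filter_upwards [lt_mem_nhds hs] with y hy
        have := hmax a y hy; linarith) hη
  have h3 : ∀ᶠ h in 𝓝[>] (0:ℝ), h < s := nhdsWithin_le_nhds (gt_mem_nhds hs)
  obtain ⟨h, ⟨⟨h1a, h1b⟩, h2a, h2b⟩, h3, h4⟩ :=
    ((h1.and h2).and (h3.and self_mem_nhdsWithin)).exists
  have h4 : 0 < h := h4
  exact ⟨h, h4, h3, by linarith, by linarith, by linarith, by linarith⟩

lemma eventually_lt_integral {μ : ℕ → Measure ℝ} {ν : Measure ℝ}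
    [IsFiniteMeasure ν]
    (hμ : ∀ f : BoundedContinuousFunction ℝ ℝ,
      Tendsto (fun n => ∫ x, f x ∂(μ n)) atTop (𝓝 (∫ x, f x ∂ν)))
    {g : ℝ → ℝ} (hg : Continuous g) (hg0 : ∀ x, 0 ≤ g x) (hgν : Integrable g ν)
    (hgμ : ∀ᶠ n in atTop, Integrable g (μ n)) {c : ℝ} (hc : c < ∫ x, g x ∂ν) :
    ∀ᶠ n in atTop, c < ∫ x, g x ∂(μ n) := by
  have h1 : Tendsto (fun k : ℕ => ∫ x, min (g x) k ∂ν) atTop (𝓝 (∫ x, g x ∂ν)) := by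
    refine tendsto_integral_of_dominated_convergence g
      (fun k => (hg.min continuous_const).aestronglyMeasurable) hgν
      (fun k => ae_of_all _ fun x => ?_) (ae_of_all _ fun x => ?_)
    · rw [Real.norm_of_nonneg (le_min (hg0 x) (Nat.cast_nonneg k))]
      exact min_le_left _ _
    · refine tendsto_const_nhds.congr' ?_
      filter_upwards [eventually_ge_atTop ⌈g x⌉₊] with k hk
      rw [min_eq_left ((Nat.le_ceil _).trans (by exact_mod_cast hk))]
  obtain ⟨k, hk⟩ := (h1.eventually (lt_mem_nhds hc)).exists
  let f : BoundedContinuousFunction ℝ ℝ := BoundedContinuousFunction.ofNormedAddCommGroup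
    (fun x => min (g x) k) (hg.min continuous_const) k fun x => by
      rw [Real.norm_of_nonneg (le_min (hg0 x) (Nat.cast_nonneg k))]
      exact min_le_right _ _
  filter_upwards [(hμ f).eventually (lt_mem_nhds hk), hgμ] with n hn hi
  refine hn.trans_le (integral_mono_of_nonneg
    (ae_of_all _ fun x => le_min (hg0 x) (Nat.cast_nonneg k)) hi
    (ae_of_all _ fun x => min_le_left _ _))

/-- Weak convergence upgrades to convergence of integrals of functions dominated by a function
whose integrals converge. -/
lemma tendsto_integral_of_le {μ : ℕ → Measure ℝ} {ν : Measure ℝ}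
    [IsFiniteMeasure ν]
    (hμ : ∀ f : BoundedContinuousFunction ℝ ℝ,
      Tendsto (fun n => ∫ x, f x ∂(μ n)) atTop (𝓝 (∫ x, f x ∂ν)))
    {f M : ℝ → ℝ} (hf : Continuous f) (hM : Continuous M) (hf0 : ∀ x, 0 ≤ f x)
    (hfM : ∀ x, f x ≤ M x) (hfν : Integrable f ν) (hMν : Integrable M ν)
    (hfμ : ∀ᶠ n in atTop, Integrable f (μ n)) (hMμ : ∀ᶠ n in atTop, Integrable M (μ n))
    (hlim : Tendsto (fun n => ∫ x, M x ∂(μ n)) atTop (𝓝 (∫ x, M x ∂ν))) :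
    Tendsto (fun n => ∫ x, f x ∂(μ n)) atTop (𝓝 (∫ x, f x ∂ν)) := by
  refine tendsto_order.2 ⟨fun c hc => eventually_lt_integral hμ hf hf0 hfν hfμ hc, fun c hc => ?_⟩
  set ε := (c - ∫ x, f x ∂ν) / 2 with hε
  have hεpos : 0 < ε := by linarith
  have h1 : (∫ x, M x ∂ν) - c + ε < ∫ x, (M x - f x) ∂ν := by
    rw [integral_sub hMν hfν]; linarith
  filter_upwards [eventually_lt_integral hμ (hM.sub hf) (fun x => sub_nonneg.2 (hfM x))
    (hMν.sub hfν) (by filter_upwards [hfμ, hMμ] with n h1 h2 using h2.sub h1) h1,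
    hlim.eventually (gt_mem_nhds (show _ < (∫ x, M x ∂ν) + ε by linarith)), hfμ, hMμ]
    with n h2 h3 h4 h5
  simp only [Pi.sub_apply] at h2
  rw [integral_sub h5 h4] at h2
  linarith

lemma integrable_empMeas {n : ℕ} (hn : 0 < n) (θ : Fin n → ℝ) (f : ℝ → ℝ) :
    Integrable f (empMeas n θ) := by
  unfold empMeas
  refine Integrable.smul_measure ?_ (by simp [hn.ne'])
  exact integrable_finsetSum_measure.2 fun i _ => integrable_dirac (by simp)

lemma integral_empMeas (n : ℕ) (θ : Fin n → ℝ) (f : ℝ → ℝ) :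
    ∫ u, f u ∂(empMeas n θ) = (n : ℝ)⁻¹ * ∑ i, f (√n * θ i) := by
  unfold empMeas
  rw [integral_smul_measure, integral_finsetSum_measure
    fun i _ => integrable_dirac (by simp)]
  simp

lemma tendsto_phiP {p : ℝ} (hp : 1 < p) {ν : Measure ℝ} [IsProbabilityMeasure ν]
    (hν : mom (p/(p-1)) ν ≠ ⊤) {θ : (n : ℕ) → Fin n → ℝ}
    (hw : ∀ f : BoundedContinuousFunction ℝ ℝ,
      Tendsto (fun n => ∫ x, f x ∂(empMeas n (θ n))) atTop (𝓝 (∫ x, f x ∂ν)))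
    (hm : Tendsto (fun n => mom (p/(p-1)) (empMeas n (θ n))) atTop (𝓝 (mom (p/(p-1)) ν)))
    (t : ℝ) : Tendsto (fun n => phiP p (empMeas n (θ n)) t) atTop (𝓝 (phiP p ν t)) := by
  have hq : 0 ≤ p/(p-1) := div_nonneg (by linarith) (by linarith)
  obtain ⟨C, -, hC⟩ := exists_cgfP_mul_le hp t
  have hmom : ∀ μ : Measure ℝ, (mom (p/(p-1)) μ).toReal = ∫ u, |u| ^ (p/(p-1)) ∂μ := fun μ =>
    (integral_eq_lintegral_of_nonneg_ae (ae_of_all _ fun u => by positivity)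
      (measurable_id.abs.pow_const _).aestronglyMeasurable).symm
  have hintν := integrable_abs_rpow_of_mom hν
  have h1 : Tendsto (fun n => ∫ u, |u| ^ (p/(p-1)) ∂(empMeas n (θ n))) atTop
      (𝓝 (∫ u, |u| ^ (p/(p-1)) ∂ν)) := by
    simp only [← hmom]
    exact (ENNReal.tendsto_toReal hν).comp hm
  have h2 : Tendsto (fun n => ∫ _u, (1:ℝ) ∂(empMeas n (θ n))) atTop (𝓝 (∫ _u, (1:ℝ) ∂ν)) :=
    hw (BoundedContinuousFunction.const ℝ 1)
  have hae : ∀ f : ℝ → ℝ, ∀ᶠ n in atTop, Integrable f (empMeas n (θ n)) := fun f => by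
    filter_upwards [eventually_gt_atTop 0] with n hn using integrable_empMeas hn _ f
  refine tendsto_integral_of_le hw ((continuous_cgfP hp).comp (by fun_prop))
    (M := fun u => C * (1 + |u| ^ (p/(p-1)))) ?_ (fun u => cgfP_nonneg hp _) hC
    (integrable_cgfP_mul hp hν t) (((integrable_const (1:ℝ)).add hintν).const_mul C)
    (hae _) (hae _) ?_
  · exact continuous_const.mul (continuous_const.add (continuous_abs.rpow_const fun _ => Or.inr hq))
  · simp only [integral_const_mul]
    refine Tendsto.const_mul C ?_
    rw [integral_add (integrable_const _) hintν]
    refine (h2.add h1).congr' ?_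
    filter_upwards [hae fun _ => 1, hae fun u => |u| ^ (p/(p-1))] with n h3 h4
    rw [integral_add h3 h4]

lemma tendsto_psiR {p : ℝ} (hp : 1 < p) {ν : Measure ℝ} [IsProbabilityMeasure ν]
    (hν : mom (p/(p-1)) ν ≠ ⊤) {θ : (n : ℕ) → Fin n → ℝ}
    (hw : ∀ f : BoundedContinuousFunction ℝ ℝ,
      Tendsto (fun n => ∫ x, f x ∂(empMeas n (θ n))) atTop (𝓝 (∫ x, f x ∂ν)))
    (hm : Tendsto (fun n => mom (p/(p-1)) (empMeas n (θ n))) atTop (𝓝 (mom (p/(p-1)) ν)))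
    (a s : ℝ) : Tendsto (fun n => psiR p (empMeas n (θ n)) a s) atTop (𝓝 (psiR p ν a s)) :=
  (tendsto_phiP hp hν hw hm _).sub_const _

/-- The normalized one-dimensional projection in direction `θ`. -/
def proj (p : ℝ) {n : ℕ} (θ x : Fin n → ℝ) : ℝ := (n : ℝ) ^ (1/p - 1/2 : ℝ) * dotp x θ

/-- The `p`-th power of the `ℓ^p` norm. -/
def powSum (p : ℝ) {n : ℕ} (x : Fin n → ℝ) : ℝ := ∑ i, |x i| ^ p

/-- The logarithmic reference scale of volumes. -/
def volScale (p : ℝ) (n : ℕ) : ℝ := ((n : ℝ) ^ (-1/p) * normC p) ^ n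

lemma volScale_pos {p : ℝ} (hp : 1 < p) {n : ℕ} (hn : 0 < n) : 0 < volScale p n := by
  have := normC_pos hp
  unfold volScale; positivity

lemma measurable_proj (p : ℝ) {n : ℕ} (θ : Fin n → ℝ) : Measurable (proj p θ) := by
  unfold proj dotp; fun_prop

lemma measurable_powSum (p : ℝ) {n : ℕ} : Measurable (powSum p (n := n)) := by
  unfold powSum; fun_prop

lemma exp_tilt_eq_prod (p a s : ℝ) {n : ℕ} (θ x : Fin n → ℝ) :
    Real.exp (n * (a * proj p θ x - s * powSum p x)) =
      ∏ i, Real.exp ((n * a * (n : ℝ) ^ (1/p - 1/2 : ℝ) * θ i) * x i - (n * s) * |x i| ^ p) := by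
  rw [← Real.exp_sum, Finset.sum_sub_distrib, ← Finset.mul_sum]
  congr 1
  unfold proj powSum dotp
  rw [mul_sub, Finset.mul_sum, Finset.mul_sum, Finset.mul_sum]
  congr 1
  · exact Finset.sum_congr rfl fun i _ => by ring
  · ring

lemma integrable_exp_tilt {p : ℝ} (hp : 1 < p) {n : ℕ} (hn : 0 < n) (θ : Fin n → ℝ)
    (a : ℝ) {s : ℝ} (hs : 0 < s) :
    Integrable fun x => Real.exp (n * (a * proj p θ x - s * powSum p x)) := by
  simp only [exp_tilt_eq_prod]
  exact Integrable.fintype_prod fun i => integrable_weight hp _ (s := n * s) (by positivity)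

lemma integral_exp_tilt {p : ℝ} (hp : 1 < p) {n : ℕ} (hn : 0 < n) (θ : Fin n → ℝ)
    (a : ℝ) {s : ℝ} (hs : 0 < s) :
    ∫ x, Real.exp (n * (a * proj p θ x - s * powSum p x)) =
      volScale p n * Real.exp (n * psiR p (empMeas n θ) a s) := by
  have hp0 : 0 < p := by linarith
  have hn0 : (0:ℝ) < n := by exact_mod_cast hn
  have hps : 0 < p * s := by positivity
  simp only [exp_tilt_eq_prod]
  rw [integral_fintype_prod_volume_eq_prod (f := fun i y =>
    Real.exp ((n * a * (n : ℝ) ^ (1/p - 1/2 : ℝ) * θ i) * y - (n * s) * |y| ^ p))]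
  have key : ∀ i, ∫ y : ℝ, Real.exp ((n * a * (n : ℝ) ^ (1/p - 1/2 : ℝ) * θ i) * y
        - (n * s) * |y| ^ p) = ((n : ℝ) ^ (-1/p) * normC p) *
        (Real.exp (-(Real.log (p * s) / p)) *
          Real.exp (cgfP p (a * (p * s) ^ (-1/p) * (√n * θ i)))) := by
    intro i
    change partFn p _ _ = _
    rw [partFn_scale hp _ (by positivity : 0 < n * s), exp_cgfP hp]
    have h1 : (p * (n * s)) ^ (-1/p) = (n : ℝ) ^ (-1/p) * (p * s) ^ (-1/p) := by
      rw [← Real.mul_rpow hn0.le hps.le]; ring_nf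
    have h2 : Real.exp (-(Real.log (p * s) / p)) = (p * s) ^ (-1/p) := by
      rw [Real.rpow_def_of_pos hps]; ring_nf
    have h3 : (n : ℝ) * (n : ℝ) ^ (1/p - 1/2 : ℝ) * (n : ℝ) ^ (-1/p) = √n := by
      rw [Real.sqrt_eq_rpow]
      nth_rewrite 1 [← Real.rpow_one (n : ℝ)]
      rw [← Real.rpow_add hn0, ← Real.rpow_add hn0]
      congr 1; ring
    have h4 := (normC_pos hp).ne'
    rw [h1, h2, ← h3]
    field_simp
  rw [Finset.prod_congr rfl fun i _ => key i]
  simp only [← Real.exp_add]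
  rw [Finset.prod_mul_distrib, ← Real.exp_sum, Finset.sum_add_distrib]
  simp only [Finset.prod_const, Finset.card_univ, Fintype.card_fin, Finset.sum_const,
    nsmul_eq_mul]
  unfold volScale psiR phiP
  rw [integral_empMeas]
  congr 2
  field_simp
  ring

lemma lintegral_exp_tilt {p : ℝ} (hp : 1 < p) {n : ℕ} (hn : 0 < n) (θ : Fin n → ℝ)
    (a : ℝ) {s : ℝ} (hs : 0 < s) :
    ∫⁻ x, ENNReal.ofReal (Real.exp (n * (a * proj p θ x - s * powSum p x))) =
      ENNReal.ofReal (volScale p n * Real.exp (n * psiR p (empMeas n θ) a s)) := by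
  rw [← integral_exp_tilt hp hn θ a hs, ofReal_integral_eq_lintegral_ofReal
    (integrable_exp_tilt hp hn θ a hs) (ae_of_all _ fun x => (Real.exp_pos _).le)]

/-- Chernoff bound for an exponentially tilted volume. -/
lemma setLIntegral_exp_tilt_le {p : ℝ} (hp : 1 < p) {n : ℕ} (hn : 0 < n) (θ : Fin n → ℝ)
    {a s a' s' b : ℝ} (hs' : 0 < s') {A : Set (Fin n → ℝ)}
    (hA : ∀ x ∈ A, b ≤ (a' - a) * proj p θ x - (s' - s) * powSum p x) :
    ∫⁻ x in A, ENNReal.ofReal (Real.exp (n * (a * proj p θ x - s * powSum p x))) ≤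
      ENNReal.ofReal (volScale p n * Real.exp (n * (psiR p (empMeas n θ) a' s' - b))) := by
  have h1 := measurable_proj p θ
  have h2 := measurable_powSum p (n := n)
  calc _ ≤ ∫⁻ x in A, ENNReal.ofReal (Real.exp (-(n * b))) *
          ENNReal.ofReal (Real.exp (n * (a' * proj p θ x - s' * powSum p x))) := by
        refine setLIntegral_mono (by fun_prop) fun x hx => ?_
        rw [← ENNReal.ofReal_mul (Real.exp_pos _).le, ← Real.exp_add]
        refine ENNReal.ofReal_le_ofReal (Real.exp_le_exp.2 ?_)
        have := mul_le_mul_of_nonneg_left (hA x hx) (Nat.cast_nonneg n (α := ℝ))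
        linarith
    _ ≤ ∫⁻ x, ENNReal.ofReal (Real.exp (-(n * b))) *
          ENNReal.ofReal (Real.exp (n * (a' * proj p θ x - s' * powSum p x))) :=
        setLIntegral_le_lintegral _ _
    _ = _ := by
        rw [lintegral_const_mul _ (by fun_prop), lintegral_exp_tilt hp hn θ a' hs',
          ← ENNReal.ofReal_mul (Real.exp_pos _).le, mul_left_comm, ← Real.exp_add]
        ring_nf

/-- Chernoff bound for volumes. -/
lemma volume_le_of_le {p : ℝ} (hp : 1 < p) {n : ℕ} (hn : 0 < n) (θ : Fin n → ℝ)
    {a s b : ℝ} (hs : 0 < s) {A : Set (Fin n → ℝ)}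
    (hA : ∀ x ∈ A, b ≤ a * proj p θ x - s * powSum p x) :
    volume A ≤ ENNReal.ofReal (volScale p n * Real.exp (n * (psiR p (empMeas n θ) a s - b))) := by
  have := setLIntegral_exp_tilt_le hp hn θ (a := 0) (s := 0) hs
    (A := A) fun x hx => by simpa using hA x hx
  simpa using this

lemma eventually_mul_exp_le {U V : ℕ → ℝ} {u v : ℝ} (hU : Tendsto U atTop (𝓝 u))
    (hV : Tendsto V atTop (𝓝 v)) (huv : u < v) {K : ℝ} (hK : 0 < K) :
    ∀ᶠ n : ℕ in atTop, K * Real.exp (n * U n) ≤ Real.exp (n * V n) := by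
  have h1 := (hV.sub hU).eventually (lt_mem_nhds (show (v - u) / 2 < v - u by linarith))
  have h2 := (tendsto_natCast_atTop_atTop (R := ℝ)).eventually_ge_atTop
    (Real.log K / ((v - u) / 2))
  filter_upwards [h1, h2] with n h1 h2
  rw [div_le_iff₀ (by linarith)] at h2
  rw [← Real.exp_log hK, ← Real.exp_add]
  refine Real.exp_le_exp.2 ?_
  have := mul_le_mul_of_nonneg_left h1.le (Nat.cast_nonneg n (α := ℝ))
  linarith

/-- Lower volume bound around a point where the supremum defining the rate is attained. -/
lemma eventually_le_volume {p : ℝ} (hp : 1 < p) {ν : Measure ℝ} [IsProbabilityMeasure ν]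
    (hν : mom (p/(p-1)) ν ≠ ⊤) {θ : (n : ℕ) → Fin n → ℝ}
    (hψ : ∀ a s, 0 < s → Tendsto (fun n => psiR p (empMeas n (θ n)) a s) atTop
      (𝓝 (psiR p ν a s)))
    {w a s : ℝ} (hs : 0 < s)
    (hmax : ∀ a' s' : ℝ, 0 < s' → a' * w - s' - psiR p ν a' s' ≤ a * w - s - psiR p ν a s)
    {η δ : ℝ} (hη : 0 < η) (hδ : 0 < δ) :
    ∀ᶠ n : ℕ in atTop,
      ENNReal.ofReal (volScale p n * Real.exp (-n * (a * w - s - psiR p ν a s + δ))) ≤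
        volume {x : Fin n → ℝ | |proj p (θ n) x - w| < η ∧ |powSum p x - 1| < η} := by
  wlog hsmall : η * (|a| + s) ≤ δ / 2 generalizing η
  · have has : 0 < |a| + s := by positivity
    have h1 : 0 < min η (δ / 2 / (|a| + s)) := lt_min hη (by positivity)
    refine (this h1 ?_).mono fun n hn => hn.trans (measure_mono fun x hx => ?_)
    · exact (mul_le_mul_of_nonneg_right (min_le_right _ _) has.le).trans
        (div_mul_cancel₀ _ has.ne').le
    · exact ⟨hx.1.trans_le (min_le_left _ _), hx.2.trans_le (min_le_left _ _)⟩
  obtain ⟨h, h0, hhs, t1, t2, t3, t4⟩ := exists_tilt hp hν hs hmax hη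
  have hψ0 := hψ a s hs
  have e1 := eventually_mul_exp_le ((hψ (a + h) s hs).sub_const (h * (w + η))) hψ0 t1
    (show (0:ℝ) < 8 by norm_num)
  have e2 := eventually_mul_exp_le ((hψ (a - h) s hs).add_const (h * (w - η))) hψ0 t2
    (show (0:ℝ) < 8 by norm_num)
  have e3 := eventually_mul_exp_le ((hψ a (s - h) (by linarith)).sub_const (h * (1 + η))) hψ0 t3
    (show (0:ℝ) < 8 by norm_num)
  have e4 := eventually_mul_exp_le ((hψ a (s + h) (by linarith)).add_const (h * (1 - η))) hψ0 t4
    (show (0:ℝ) < 8 by norm_num)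
  have e5 := eventually_mul_exp_le (U := fun _ => psiR p ν a s - δ / 2) tendsto_const_nhds hψ0
    (by linarith) (show (0:ℝ) < 2 by norm_num)
  filter_upwards [e1, e2, e3, e4, e5, eventually_gt_atTop 0] with n e1 e2 e3 e4 e5 hn
  have hD := volScale_pos hp hn
  set D := volScale p n
  set ψ := psiR p (empMeas n (θ n)) a s
  set E := {x : Fin n → ℝ | |proj p (θ n) x - w| < η ∧ |powSum p x - 1| < η}
  set Q : (Fin n → ℝ) → ℝ≥0∞ := fun x =>
    ENNReal.ofReal (Real.exp (n * (a * proj p (θ n) x - s * powSum p x)))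
  set A₁ := {x : Fin n → ℝ | w + η ≤ proj p (θ n) x}
  set A₂ := {x : Fin n → ℝ | proj p (θ n) x ≤ w - η}
  set A₃ := {x : Fin n → ℝ | 1 + η ≤ powSum p x}
  set A₄ := {x : Fin n → ℝ | powSum p x ≤ 1 - η}
  have hcover : univ ⊆ E ∪ (A₁ ∪ (A₂ ∪ (A₃ ∪ A₄))) := by
    intro x _
    by_contra hx
    simp only [mem_union, not_or] at hx
    obtain ⟨h0, h1, h2, h3, h4⟩ := hx
    simp only [A₁, A₂, A₃, A₄, mem_ofPred_eq, not_le] at h1 h2 h3 h4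
    exact h0 ⟨abs_lt.2 ⟨by linarith, by linarith⟩, abs_lt.2 ⟨by linarith, by linarith⟩⟩
  have hZ : ∀ {U : ℝ}, 8 * Real.exp (n * U) ≤ Real.exp (n * ψ) →
      ENNReal.ofReal (D * Real.exp (n * U)) ≤ ENNReal.ofReal (D * Real.exp (n * ψ) / 8) :=
    fun hU => ENNReal.ofReal_le_ofReal (by
      rw [le_div_iff₀ (by norm_num)]
      have := mul_le_mul_of_nonneg_left hU hD.le
      linarith)
  have b1 : ∫⁻ x in A₁, Q x ≤ ENNReal.ofReal (D * Real.exp (n * ψ) / 8) := by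
    refine (setLIntegral_exp_tilt_le hp hn (θ n) hs (a' := a + h) (b := h * (w + η))
      fun x hx => ?_).trans (hZ e1)
    have := mul_le_mul_of_nonneg_left (show w + η ≤ proj p (θ n) x from hx) h0.le
    linarith
  have b2 : ∫⁻ x in A₂, Q x ≤ ENNReal.ofReal (D * Real.exp (n * ψ) / 8) := by
    refine (setLIntegral_exp_tilt_le hp hn (θ n) hs (a' := a - h) (b := -(h * (w - η)))
      fun x hx => ?_).trans (hZ (by rwa [sub_neg_eq_add]))
    have := mul_le_mul_of_nonneg_left (show proj p (θ n) x ≤ w - η from hx) h0.le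
    linarith
  have b3 : ∫⁻ x in A₃, Q x ≤ ENNReal.ofReal (D * Real.exp (n * ψ) / 8) := by
    refine (setLIntegral_exp_tilt_le hp hn (θ n) (a' := a) (s' := s - h) (by linarith)
      (b := h * (1 + η)) fun x hx => ?_).trans (hZ e3)
    have := mul_le_mul_of_nonneg_left (show 1 + η ≤ powSum p x from hx) h0.le
    linarith
  have b4 : ∫⁻ x in A₄, Q x ≤ ENNReal.ofReal (D * Real.exp (n * ψ) / 8) := by
    refine (setLIntegral_exp_tilt_le hp hn (θ n) (a' := a) (s' := s + h) (by linarith)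
      (b := -(h * (1 - η))) fun x hx => ?_).trans (hZ (by rwa [sub_neg_eq_add]))
    have := mul_le_mul_of_nonneg_left (show powSum p x ≤ 1 - η from hx) h0.le
    linarith
  have hE : ∫⁻ x in E, Q x ≤
      ENNReal.ofReal (Real.exp (n * (a * w - s + δ / 2))) * volume E := by
    rw [← setLIntegral_const]
    refine setLIntegral_mono measurable_const fun x hx => ?_
    refine ENNReal.ofReal_le_ofReal (Real.exp_le_exp.2
      (mul_le_mul_of_nonneg_left ?_ (Nat.cast_nonneg n)))
    have h1 : a * (proj p (θ n) x - w) ≤ |a| * η := (le_abs_self _).trans (by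
      rw [abs_mul]; exact mul_le_mul_of_nonneg_left hx.1.le (abs_nonneg a))
    have h2 := mul_le_mul_of_nonneg_left (abs_lt.1 hx.2).1.le hs.le
    linarith
  have htot : ENNReal.ofReal (D * Real.exp (n * ψ)) ≤ (∫⁻ x in E, Q x)
      + ENNReal.ofReal (D * Real.exp (n * ψ) / 2) := by
    rw [← lintegral_exp_tilt hp hn (θ n) a hs, ← setLIntegral_univ]
    refine (lintegral_mono_set hcover).trans ((lintegral_union_le _ _ _).trans
      (add_le_add_right ?_ _))
    refine (lintegral_union_le _ _ _).trans ((add_le_add b1 ((lintegral_union_le _ _ _).trans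
      (add_le_add b2 ((lintegral_union_le _ _ _).trans (add_le_add b3 b4))))).trans ?_)
    have h8 : 0 ≤ D * Real.exp (n * ψ) / 8 := by positivity
    rw [← ENNReal.ofReal_add h8 h8, ← ENNReal.ofReal_add h8 (by positivity),
      ← ENNReal.ofReal_add h8 (by positivity)]
    exact ENNReal.ofReal_le_ofReal (by linarith)
  have hhalf : ENNReal.ofReal (D * Real.exp (n * ψ) / 2) ≤ ∫⁻ x in E, Q x := by
    have h2 : 0 ≤ D * Real.exp (n * ψ) / 2 := by positivity
    rw [show D * Real.exp (n * ψ) = D * Real.exp (n * ψ) / 2 + D * Real.exp (n * ψ) / 2 by ring,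
      ENNReal.ofReal_add h2 h2] at htot
    rw [show (D * Real.exp (n * ψ) / 2 + D * Real.exp (n * ψ) / 2) / 2
      = D * Real.exp (n * ψ) / 2 by ring] at htot
    exact ENNReal.le_of_add_le_add_right ENNReal.ofReal_ne_top htot
  refine (ENNReal.mul_le_mul_iff_right (a := ENNReal.ofReal (Real.exp (n * (a * w - s + δ / 2))))
    (by simp [Real.exp_pos]) ENNReal.ofReal_ne_top).1 (le_trans ?_ (hhalf.trans hE))
  rw [← ENNReal.ofReal_mul (Real.exp_pos _).le, mul_left_comm, ← Real.exp_add]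
  refine ENNReal.ofReal_le_ofReal ?_
  have := mul_le_mul_of_nonneg_left e5 hD.le
  rw [show (n : ℝ) * (a * w - s + δ / 2) + -n * (a * w - s - psiR p ν a s + δ)
    = n * (psiR p ν a s - δ / 2) by ring]
  linarith

lemma volume_lpBall_le {p : ℝ} (hp : 1 < p) {n : ℕ} (hn : 0 < n) :
    volume (lpBall n p) ≤ ENNReal.ofReal (volScale p n * Real.exp (n * (1/p))) := by
  have hp0 : 0 < p := by linarith
  have := volume_le_of_le hp hn 0 (a := 0) (s := 1/p) (b := -(1/p)) (by positivity)
    (A := lpBall n p) fun x hx => by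
      have := mul_le_mul_of_nonneg_left (show powSum p x ≤ 1 from hx) (show 0 ≤ 1/p by positivity)
      linarith
  rwa [psiR_zero hp, zero_sub, neg_neg] at this

lemma proj_smul (p : ℝ) {n : ℕ} (θ x : Fin n → ℝ) (r : ℝ) :
    proj p θ (r • x) = r * proj p θ x := by
  simp only [proj, dotp, Pi.smul_apply, smul_eq_mul, mul_assoc, ← Finset.mul_sum]
  ring

lemma powSum_smul (p : ℝ) {n : ℕ} (x : Fin n → ℝ) {r : ℝ} (hr : 0 ≤ r) :
    powSum p (r • x) = r ^ p * powSum p x := by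
  simp only [powSum, Pi.smul_apply, smul_eq_mul, abs_mul, abs_of_nonneg hr,
    Real.mul_rpow hr (abs_nonneg _), ← Finset.mul_sum]

open scoped Pointwise in
/-- Lower bound for the volume of the part of the ball projected into an open set. -/
lemma eventually_le_volume_inter_lpBall {p : ℝ} (hp : 1 < p) {ν : Measure ℝ}
    [IsProbabilityMeasure ν] (hν : mom (p/(p-1)) ν ≠ ⊤) {θ : (n : ℕ) → Fin n → ℝ}
    (hψ : ∀ a s, 0 < s → Tendsto (fun n => psiR p (empMeas n (θ n)) a s) atTop
      (𝓝 (psiR p ν a s)))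
    {w a s : ℝ} (hs : 0 < s)
    (hmax : ∀ a' s' : ℝ, 0 < s' → a' * w - s' - psiR p ν a' s' ≤ a * w - s - psiR p ν a s)
    {G : Set ℝ} (hG : IsOpen G) (hw : w ∈ G) {δ : ℝ} (hδ : 0 < δ) :
    ∀ᶠ n : ℕ in atTop,
      ENNReal.ofReal (volScale p n * Real.exp (-n * (a * w - s - psiR p ν a s + δ))) ≤
        volume (proj p (θ n) ⁻¹' G ∩ lpBall n p) := by
  have hp0 : 0 < p := by linarith
  have hcont : ContinuousAt (fun y : ℝ × ℝ => (1 + y.1) ^ (-1/p) * y.2) (0, w) :=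
    ((continuousAt_const.add continuousAt_fst).rpow_const (Or.inl (by simp))).mul continuousAt_snd
  have hmem := hcont.preimage_mem_nhds (hG.mem_nhds (by simpa using hw))
  obtain ⟨ε, hε, hball⟩ := Metric.mem_nhds_iff.1 hmem
  set η := min (ε / 2) (p * (δ / 2)) with hη
  have hη0 : 0 < η := by positivity
  have hηε : η < ε := (min_le_left _ _).trans_lt (by linarith)
  set r := (1 + η) ^ (-1/p) with hr
  have hr0 : 0 < r := by positivity
  have hrp : r ^ p * (1 + η) = 1 := by
    rw [hr, ← Real.rpow_mul (by positivity), div_mul_cancel₀ _ hp0.ne', Real.rpow_neg_one,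
      inv_mul_cancel₀ (by positivity)]
  have hrexp : Real.exp (-(δ / 2)) ≤ r := by
    rw [hr, Real.rpow_def_of_pos (by positivity)]
    refine Real.exp_le_exp.2 ?_
    have h1 : Real.log (1 + η) ≤ p * (δ / 2) :=
      (Real.log_le_sub_one_of_pos (by positivity)).trans (by
        have := min_le_right (ε / 2) (p * (δ / 2)); linarith)
    have h2 := div_le_div_of_nonneg_right h1 hp0.le
    rw [mul_div_cancel_left₀ _ hp0.ne'] at h2
    rw [mul_div_assoc', mul_neg_one, neg_div]
    linarith
  filter_upwards [eventually_le_volume hp hν hψ hs hmax hη0 (half_pos hδ),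
    eventually_gt_atTop 0] with n hn hn0
  set E := {x : Fin n → ℝ | |proj p (θ n) x - w| < η ∧ |powSum p x - 1| < η}
  have hsub : r • E ⊆ proj p (θ n) ⁻¹' G ∩ lpBall n p := by
    rintro _ ⟨x, ⟨hx1, hx2⟩, rfl⟩
    constructor
    · change proj p (θ n) (r • x) ∈ G
      rw [proj_smul]
      refine hball (a := (η, proj p (θ n) x)) ?_
      rw [Metric.mem_ball, Prod.dist_eq, max_lt_iff, Real.dist_eq, Real.dist_eq, sub_zero,
        abs_of_pos hη0]
      exact ⟨hηε, hx1.trans hηε⟩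
    · change powSum p (r • x) ≤ 1
      rw [powSum_smul p x hr0.le, ← hrp]
      exact mul_le_mul_of_nonneg_left (by linarith [(abs_lt.1 hx2).2]) (by positivity)
  refine le_trans ?_ (measure_mono hsub)
  rw [Measure.addHaar_smul, Module.finrank_fin_fun, abs_of_nonneg (by positivity)]
  refine le_trans ?_ (mul_le_mul_right hn _)
  rw [← ENNReal.ofReal_mul (by positivity)]
  refine ENNReal.ofReal_le_ofReal ?_
  have hD := volScale_pos hp hn0
  calc _ = Real.exp (-(δ / 2)) ^ n *
        (volScale p n * Real.exp (-n * (a * w - s - psiR p ν a s + δ / 2))) := by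
        rw [← Real.exp_nat_mul, mul_left_comm, ← Real.exp_add]
        ring_nf
    _ ≤ _ := by gcongr

lemma eventually_le_volume_lpBall {p : ℝ} (hp : 1 < p) {ν : Measure ℝ} [IsProbabilityMeasure ν]
    (hν : mom (p/(p-1)) ν ≠ ⊤) {θ : (n : ℕ) → Fin n → ℝ}
    (hψ : ∀ a s, 0 < s → Tendsto (fun n => psiR p (empMeas n (θ n)) a s) atTop
      (𝓝 (psiR p ν a s))) {δ : ℝ} (hδ : 0 < δ) :
    ∀ᶠ n : ℕ in atTop,
      ENNReal.ofReal (volScale p n * Real.exp (n * (1/p - δ))) ≤ volume (lpBall n p) := by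
  have hp0 : 0 < p := by linarith
  filter_upwards [eventually_le_volume_inter_lpBall hp hν hψ (by positivity : 0 < 1/p)
    (fun a' s' hs' => isMax_zero hp ν a' s' hs') isOpen_univ (mem_univ 0) hδ] with n hn
  rw [psiR_zero hp, preimage_univ, univ_inter] at hn
  convert hn using 4
  ring

lemma coe_le_inv_mul_log {n : ℕ} (hn : 0 < n) {c : ℝ} {x : ℝ≥0∞}
    (h : ENNReal.ofReal (Real.exp (n * c)) ≤ x) :
    (c : EReal) ≤ (((n : ℝ)⁻¹ : ℝ) : EReal) * ENNReal.log x := by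
  have hn0 : (n : ℝ) ≠ 0 := by positivity
  have h1 := ENNReal.log_le_log h
  rw [ENNReal.log_ofReal_of_pos (Real.exp_pos _), Real.log_exp] at h1
  calc (c : EReal) = (((n : ℝ)⁻¹ : ℝ) : EReal) * ((n * c : ℝ) : EReal) := by
        rw [← EReal.coe_mul, inv_mul_cancel_left₀ hn0]
    _ ≤ _ := mul_le_mul_of_nonneg_left h1 (by exact_mod_cast (by positivity : 0 ≤ (n : ℝ)⁻¹))

lemma inv_mul_log_le_coe {n : ℕ} (hn : 0 < n) {c : ℝ} {x : ℝ≥0∞}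
    (h : x ≤ ENNReal.ofReal (Real.exp (n * c))) :
    (((n : ℝ)⁻¹ : ℝ) : EReal) * ENNReal.log x ≤ (c : EReal) := by
  have hn0 : (n : ℝ) ≠ 0 := by positivity
  have h1 := ENNReal.log_le_log h
  rw [ENNReal.log_ofReal_of_pos (Real.exp_pos _), Real.log_exp] at h1
  calc _ ≤ (((n : ℝ)⁻¹ : ℝ) : EReal) * ((n * c : ℝ) : EReal) :=
        mul_le_mul_of_nonneg_left h1 (by exact_mod_cast (by positivity : 0 ≤ (n : ℝ)⁻¹))
    _ = _ := by rw [← EReal.coe_mul, inv_mul_cancel_left₀ hn0]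

lemma measure_proj_mem {p : ℝ} {Ω : Type*} [MeasurableSpace Ω] {P : Measure Ω} {n : ℕ}
    {X : Ω → Fin n → ℝ} (hXm : Measurable X) (hX : Measure.map X P = uniformLpBall n p)
    (θ : Fin n → ℝ) {A : Set ℝ} (hA : MeasurableSet A) :
    P {ω | proj p θ (X ω) ∈ A} = (volume (lpBall n p))⁻¹ * volume (proj p θ ⁻¹' A ∩ lpBall n p) := by
  have hm := measurable_proj p θ hA
  rw [← Measure.restrict_apply hm, ← smul_eq_mul, ← Measure.smul_apply]
  change _ = uniformLpBall n p _
  rw [← hX, Measure.map_apply hXm hm]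
  rfl

lemma Iq_mul_le {p : ℝ} (hp : 1 < p) {ν : Measure ℝ} [IsProbabilityMeasure ν]
    (hν : mom (p/(p-1)) ν ≠ ⊤) (x : ℝ) {l : ℝ} (hl0 : 0 ≤ l) (hl1 : l ≤ 1) :
    Iq p ν (l * x) ≤ Iq p ν x := by
  have := quasiconvexRate_Iq hp hν (Iq p ν x) (show Iq p ν x ≤ Iq p ν x from le_rfl)
    (show Iq p ν (-x) ≤ Iq p ν x from (Iq_neg hp hν x).le)
    (show 0 ≤ (1 + l) / 2 by linarith) (show 0 ≤ (1 - l) / 2 by linarith) (by ring)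
  have h2 : l * x = (1 + l) / 2 * x + (1 - l) / 2 * -x := by ring
  rw [h2]
  exact this

lemma neg_Iq_le_liminf
    {p : ℝ} (hp : 1 < p) {ν : Measure ℝ} [IsProbabilityMeasure ν]
    (hν : mom (p/(p-1)) ν ≠ ⊤) {θ : (n : ℕ) → Fin n → ℝ}
    (hψ : ∀ a s, 0 < s → Tendsto (fun n => psiR p (empMeas n (θ n)) a s) atTop (𝓝 (psiR p ν a s)))
    {Ω : Type*} [MeasurableSpace Ω] {P : Measure Ω} {X : (n : ℕ) → Ω → (Fin n → ℝ)}
    (hXmeas : ∀ n, Measurable (X n)) (hX : ∀ n, 0 < n → Measure.map (X n) P = uniformLpBall n p)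
    {G : Set ℝ} (hG : IsOpen G) {x : ℝ} (hx : x ∈ G) :
    -Iq p ν x ≤ atTop.liminf fun n : ℕ =>
      (((n : ℝ)⁻¹ : ℝ) : EReal) * ENNReal.log (P {ω | proj p (θ n) (X n ω) ∈ G}) := by
  rcases eq_or_ne (Iq p ν x) ⊤ with htop | htop
  · rw [htop]; simp
  obtain ⟨l, ⟨hlG, hl1⟩, hl0⟩ : ∃ l : ℝ, (l * x ∈ G ∧ l < 1) ∧ 0 ≤ l := by
    have h1 : ∀ᶠ l : ℝ in 𝓝 1, l * x ∈ G :=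
      (continuous_mul_const x).continuousAt.preimage_mem_nhds (hG.mem_nhds (by simpa using hx))
    have h2 : ∀ᶠ l : ℝ in 𝓝 1, 0 ≤ l := (lt_mem_nhds one_pos).mono fun _ h => le_of_lt h
    have h3 : ∀ᶠ l : ℝ in 𝓝[<] 1, l * x ∈ G := nhdsWithin_le_nhds h1
    have h4 : ∀ᶠ l : ℝ in 𝓝[<] 1, l < 1 := self_mem_nhdsWithin
    exact ((h3.and h4).and (nhdsWithin_le_nhds h2)).exists
  obtain ⟨a, s, hs, hmax⟩ := exists_maximizer hp hν htop hl0 hl1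
  have hF := (le_Iq hp hν (l * x) a hs).trans (Iq_mul_le hp hν x hl0 hl1.le)
  refine (EReal.neg_le_neg_iff.2 hF).trans ?_
  rw [← EReal.coe_neg]
  refine EReal.ge_of_forall_gt_iff_ge.1 fun c hc => ?_
  have hc := EReal.coe_lt_coe_iff.1 hc
  set F := a * (l * x) - s - psiR p ν a s with hFdef
  refine le_liminf_of_le (by isBoundedDefault) ?_
  filter_upwards [eventually_le_volume_inter_lpBall hp hν hψ hs hmax hG hlG
    (show 0 < -(F + 1/p) - c by linarith), eventually_gt_atTop 0] with n hn hn0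
  refine coe_le_inv_mul_log hn0 ?_
  have hD := volScale_pos hp hn0
  have hDe : 0 < volScale p n * Real.exp (n * (1/p)) := by positivity
  rw [measure_proj_mem (hXmeas n) (hX n hn0) _ hG.measurableSet]
  refine le_trans ?_ (mul_le_mul' (ENNReal.inv_le_inv.2 (volume_lpBall_le hp hn0)) hn)
  rw [← ENNReal.ofReal_inv_of_pos hDe, ← ENNReal.ofReal_mul (by positivity)]
  refine ENNReal.ofReal_le_ofReal (le_of_eq ?_)
  rw [eq_inv_mul_iff_mul_eq₀ hDe.ne', mul_assoc, ← Real.exp_add]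
  congr 2
  linear_combination (n : ℝ) * hFdef

lemma limsup_le_neg_of_le_abs
    {p : ℝ} (hp : 1 < p) {ν : Measure ℝ} [IsProbabilityMeasure ν]
    (hν : mom (p/(p-1)) ν ≠ ⊤) {θ : (n : ℕ) → Fin n → ℝ}
    (hψ : ∀ a s, 0 < s → Tendsto (fun n => psiR p (empMeas n (θ n)) a s) atTop (𝓝 (psiR p ν a s)))
    {Ω : Type*} [MeasurableSpace Ω] {P : Measure Ω} {X : (n : ℕ) → Ω → (Fin n → ℝ)}
    (hXmeas : ∀ n, Measurable (X n)) (hX : ∀ n, 0 < n → Measure.map (X n) P = uniformLpBall n p)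
    {A : Set ℝ} (hA : MeasurableSet A) {d : ℝ} (hd : ∀ v ∈ A, d ≤ |v|)
    {a s : ℝ} (ha : 0 ≤ a) (hs : 0 < s) :
    (atTop.limsup fun n : ℕ =>
      (((n : ℝ)⁻¹ : ℝ) : EReal) * ENNReal.log (P {ω | proj p (θ n) (X n ω) ∈ A})) ≤
      ((-(a * d + 1/p - s - psiR p ν a s) : ℝ) : EReal) := by
  refine EReal.le_of_forall_lt_iff_le.1 fun c hc => ?_
  have hc := EReal.coe_lt_coe_iff.1 hc
  set δ := (c + (a * d + 1/p - s - psiR p ν a s)) / 2 with hδ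
  have hδ0 : 0 < δ := by linarith
  refine limsup_le_of_le (by isBoundedDefault) ?_
  filter_upwards [eventually_le_volume_lpBall hp hν hψ hδ0,
    eventually_mul_exp_le (hψ a s hs) (tendsto_const_nhds (x := psiR p ν a s + δ)) (by linarith)
      two_pos, eventually_gt_atTop 0] with n hB he hn0
  refine inv_mul_log_le_coe hn0 ?_
  have hD := volScale_pos hp hn0
  have hDe : 0 < volScale p n * Real.exp (n * (1/p - δ)) := by positivity
  have hup : volume {x | d ≤ proj p (θ n) x ∧ x ∈ lpBall n p} ≤ ENNReal.ofReal
      (volScale p n * Real.exp (n * (psiR p (empMeas n (θ n)) a s - (a * d - s)))) := by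
    refine volume_le_of_le hp hn0 (θ n) hs fun x hx => ?_
    have h1 := mul_le_mul_of_nonneg_left hx.1 ha
    have h2 := mul_le_mul_of_nonneg_left (show powSum p x ≤ 1 from hx.2) hs.le
    linarith
  have hlow : volume {x | proj p (θ n) x ≤ -d ∧ x ∈ lpBall n p} ≤ ENNReal.ofReal
      (volScale p n * Real.exp (n * (psiR p (empMeas n (θ n)) a s - (a * d - s)))) := by
    rw [← psiR_neg hp]
    refine volume_le_of_le hp hn0 (θ n) hs fun x hx => ?_
    have h1 := mul_le_mul_of_nonneg_left hx.1 ha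
    have h2 := mul_le_mul_of_nonneg_left (show powSum p x ≤ 1 from hx.2) hs.le
    linarith
  have hsub : proj p (θ n) ⁻¹' A ∩ lpBall n p ⊆
      {x | d ≤ proj p (θ n) x ∧ x ∈ lpBall n p} ∪ {x | proj p (θ n) x ≤ -d ∧ x ∈ lpBall n p} := by
    rintro x ⟨hx, hxB⟩
    rcases le_abs.1 (hd _ hx) with h | h
    · exact Or.inl ⟨h, hxB⟩
    · exact Or.inr ⟨by linarith, hxB⟩
  rw [measure_proj_mem (hXmeas n) (hX n hn0) _ hA]
  refine (mul_le_mul' (ENNReal.inv_le_inv.2 hB) ((measure_mono hsub).trans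
    ((measure_union_le _ _).trans (add_le_add hup hlow)))).trans ?_
  rw [← ENNReal.ofReal_add (by positivity) (by positivity), ← ENNReal.ofReal_inv_of_pos hDe,
    ← ENNReal.ofReal_mul (by positivity)]
  refine ENNReal.ofReal_le_ofReal ?_
  rw [inv_mul_le_iff₀ hDe]
  have h1 := mul_le_mul_of_nonneg_left he
    (show 0 ≤ volScale p n * Real.exp (-(n * (a * d - s))) by positivity)
  calc _ = volScale p n * Real.exp (-(n * (a * d - s))) *
        (2 * Real.exp (n * psiR p (empMeas n (θ n)) a s)) := by
        rw [mul_sub (n : ℝ) (psiR _ _ _ _), sub_eq_add_neg (_ * psiR _ _ _ _), Real.exp_add]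
        ring
    _ ≤ _ := h1
    _ = _ := by
        rw [mul_assoc, mul_assoc, ← Real.exp_add, ← Real.exp_add]
        congr 2
        linear_combination (2 * n : ℝ) * hδ

lemma limsup_le_neg_iInf_Iq
    {p : ℝ} (hp : 1 < p) {ν : Measure ℝ} [IsProbabilityMeasure ν]
    (hν : mom (p/(p-1)) ν ≠ ⊤) {θ : (n : ℕ) → Fin n → ℝ}
    (hψ : ∀ a s, 0 < s → Tendsto (fun n => psiR p (empMeas n (θ n)) a s) atTop (𝓝 (psiR p ν a s)))
    {Ω : Type*} [MeasurableSpace Ω] {P : Measure Ω} {X : (n : ℕ) → Ω → (Fin n → ℝ)}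
    (hXmeas : ∀ n, Measurable (X n)) (hX : ∀ n, 0 < n → Measure.map (X n) P = uniformLpBall n p)
    [IsProbabilityMeasure P] {A : Set ℝ} (hA : IsClosed A) :
    (atTop.limsup fun n : ℕ =>
      (((n : ℝ)⁻¹ : ℝ) : EReal) * ENNReal.log (P {ω | proj p (θ n) (X n ω) ∈ A})) ≤
      -(⨅ x ∈ A, Iq p ν x) := by
  have hp0 : 0 < p := by linarith
  rcases A.eq_empty_or_nonempty with rfl | hne
  · refine limsup_le_of_le (by isBoundedDefault) ?_
    filter_upwards [eventually_gt_atTop 0] with n hn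
    have : (0:ℝ) < (n : ℝ)⁻¹ := by positivity
    simp [EReal.coe_mul_bot_of_pos this]
  by_cases h0 : (0:ℝ) ∈ A
  · have hI0 : Iq p ν 0 ≤ 0 := by
      refine (Iq_le_iff hp hν).2 fun a s hs => ?_
      have := isMax_zero hp ν a s hs
      rw [psiR_zero hp] at this
      exact_mod_cast (show a * 0 + 1/p - s - psiR p ν a s ≤ 0 by linarith)
    have hle : (⨅ x ∈ A, Iq p ν x) ≤ 0 := (iInf₂_le 0 h0).trans hI0
    refine (limsup_le_of_le (a := (0 : EReal)) (by isBoundedDefault)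
      (Eventually.of_forall fun n => ?_)).trans (by simpa using EReal.neg_le_neg_iff.2 hle)
    refine mul_nonpos_of_nonneg_of_nonpos
      (by exact_mod_cast (by positivity : 0 ≤ (n : ℝ)⁻¹)) ?_
    rw [← ENNReal.log_one]
    exact ENNReal.log_le_log prob_le_one
  · obtain ⟨y, hyA, hy⟩ := hA.exists_infDist_eq_dist hne 0
    have hd : ∀ v ∈ A, |y| ≤ |v| := fun v hv => by
      have := Metric.infDist_le_dist_of_mem (x := (0:ℝ)) hv
      rwa [hy, dist_zero_left, dist_zero_left, Real.norm_eq_abs, Real.norm_eq_abs] at this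
    have hIy : Iq p ν y = Iq p ν |y| := by
      rcases abs_choice y with h | h <;> rw [h]
      rw [Iq_neg hp hν]
    rw [EReal.le_neg]
    refine (iInf₂_le y hyA).trans (hIy.trans_le ((Iq_le_iff hp hν).2 fun a s hs => ?_))
    rw [EReal.le_neg]
    refine (limsup_le_neg_of_le_abs hp hν hψ hXmeas hX hA.measurableSet hd (abs_nonneg a)
      hs).trans ?_
    rw [← EReal.coe_neg]
    refine EReal.coe_le_coe_iff.2 ?_
    have h1 : psiR p ν |a| s = psiR p ν a s := by
      rcases abs_choice a with h | h <;> rw [h]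
      rw [psiR_neg hp]
    have h2 := mul_le_mul_of_nonneg_right (le_abs_self a) (abs_nonneg y)
    rw [h1]; linarith

lemma isLDP_proj
    {p : ℝ} (hp : 1 < p) {ν : Measure ℝ} [IsProbabilityMeasure ν]
    (hν : mom (p/(p-1)) ν ≠ ⊤) {θ : (n : ℕ) → Fin n → ℝ}
    (hψ : ∀ a s, 0 < s → Tendsto (fun n => psiR p (empMeas n (θ n)) a s) atTop (𝓝 (psiR p ν a s)))
    {Ω : Type*} [MeasurableSpace Ω] {P : Measure Ω} {X : (n : ℕ) → Ω → (Fin n → ℝ)}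
    (hXmeas : ∀ n, Measurable (X n)) (hX : ∀ n, 0 < n → Measure.map (X n) P = uniformLpBall n p)
    [IsProbabilityMeasure P] :
    IsLDP P (fun n ω => proj p (θ n) (X n ω)) (fun n => (n : ℝ)) (Iq p ν) := by
  refine ⟨lowerSemicontinuous_Iq hp hν, fun Γ _ => ⟨?_, ?_⟩⟩
  · rw [EReal.neg_le]
    refine le_iInf₂ fun x hx => ?_
    rw [EReal.neg_le]
    exact neg_Iq_le_liminf hp hν hψ hXmeas hX isOpen_interior hx
  · exact limsup_le_neg_iInf_Iq hp hν hψ hXmeas hX isClosed_closure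

/-- Quenched LDP under Wasserstein convergence of the empirical measures of
the directions to a measure `ν`. -/
theorem statement7
    (p : ℝ) (hp : 1 < p)
    {Ω : Type*} [MeasurableSpace Ω] (P : Measure Ω) [IsProbabilityMeasure P]
    (X : (n : ℕ) → Ω → (Fin n → ℝ))
    (hXmeas : ∀ n, Measurable (X n))
    (hX : ∀ n, 0 < n → Measure.map (X n) P = uniformLpBall n p)
    (ρ : Measure ((n : ℕ) → Fin n → ℝ)) [IsProbabilityMeasure ρ]
    (hρS : ∀ᵐ θ ∂ρ, ∀ n, 0 < n → θ n ∈ unitSphereSet n)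
    (ν : Measure ℝ) [IsProbabilityMeasure ν]
    (hν : mom (p/(p-1)) ν ≠ ⊤)
    (hconv : ∀ᵐ θ ∂ρ,
      (∀ f : BoundedContinuousFunction ℝ ℝ,
        Tendsto (fun n => ∫ x, f x ∂(empMeas n (θ n))) atTop (nhds (∫ x, f x ∂ν)))
      ∧ Tendsto (fun n => mom (p/(p-1)) (empMeas n (θ n))) atTop
          (nhds (mom (p/(p-1)) ν))) :
    (∀ᵐ θ ∂ρ, IsLDP P (fun n ω => (n : ℝ) ^ (1/p - 1/2 : ℝ) * dotp (X n ω) (θ n))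
        (fun n => (n : ℝ)) (Iq p ν))
    ∧ (∀ w : ℝ, 0 ≤ Iq p ν w)
    ∧ HasCompactSublevels (Iq p ν)
    ∧ QuasiconvexRate (Iq p ν)
    ∧ SymmetricRate (Iq p ν) := by
  refine ⟨?_, Iq_nonneg hp hν, hasCompactSublevels_Iq hp hν, quasiconvexRate_Iq hp hν,
    Iq_neg hp hν⟩
  filter_upwards [hconv] with θ hθ
  exact isLDP_proj hp hν (fun a s _ => tendsto_psiR hp hν hθ.1 hθ.2 a s) hXmeas hX
end
end

section
/- There exists w_* ∈ (0,1) such that for every w ∈ ℝ with w_* ≤ |w| < 1, the standard Gaussian measure μ₂ does not attain the infimum in the variational formula 𝕀ᵃ_∞(w) = inf{ 𝕀^q_{∞,ν}(w) + H(ν|μ₂) + (1/2)(1 − m₂(ν)) : ν a probability measure on ℝ with m₂(ν) ≤ 1 }; in particular, for every such w the strict inequality 𝕀ᵃ_∞(w) < 𝕀^q_{∞,μ₂}(w) holds. -/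
open MeasureTheory Filter Topology Set ProbabilityTheory
open scoped ENNReal NNReal

noncomputable section

open LDP

namespace LDP

theorem muP_two : muP 2 = gaussianReal 0 1 := by
  rw [gaussianReal_of_var_ne_zero _ one_ne_zero, muP]
  congr 1
  funext y
  rw [gaussianPDF, gaussianPDFReal]
  have hG : Real.Gamma (1 + 1 / 2) = √Real.pi / 2 := by
    rw [add_comm, Real.Gamma_add_one (by norm_num), Real.Gamma_one_half_eq]
    ring
  have hs : (2 : ℝ) * 2 ^ ((1 : ℝ) / 2) * (√Real.pi / 2) = √(2 * Real.pi * ((1 : ℝ≥0) : ℝ)) := by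
    rw [← Real.sqrt_eq_rpow, NNReal.coe_one, mul_one, Real.sqrt_mul zero_le_two]
    ring
  rw [hG, hs, Real.rpow_two, sq_abs]
  simp

instance : IsProbabilityMeasure (muP 2) := by
  rw [muP_two]
  infer_instance

instance : (muP 2).IsOpenPosMeasure := by
  rw [muP_two]
  exact (gaussianReal_absolutelyContinuous' 0 one_ne_zero).isOpenPosMeasure

instance : IsProbabilityMeasure muInf := by
  refine ⟨?_⟩
  rw [muInf, Measure.smul_apply, Measure.restrict_apply_univ, smul_eq_mul, Real.volume_Icc]
  exact ENNReal.inv_mul_cancel (by norm_num) ENNReal.ofReal_ne_top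

theorem muInf_pos_of_isOpen {U : Set ℝ} (hU : IsOpen U) {x : ℝ} (hxU : x ∈ U) (hx : |x| < 1) :
    0 < muInf U := by
  rw [muInf, Measure.smul_apply, smul_eq_mul, Measure.restrict_apply hU.measurableSet]
  refine ENNReal.mul_pos (by simp) (ne_of_gt ?_)
  refine lt_of_lt_of_le ?_ (measure_mono (inter_subset_inter_right U Ioo_subset_Icc_self))
  exact (hU.inter isOpen_Ioo).measure_pos volume ⟨x, hxU, abs_lt.1 hx⟩

theorem ae_muInf_abs_le_one : ∀ᵐ x ∂muInf, |x| ≤ 1 := by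
  refine Measure.ae_smul_measure ?_ _
  filter_upwards [ae_restrict_mem measurableSet_Icc] with x hx using abs_le.2 hx

theorem logM_muInf_le (s : ℝ) : logM muInf s ≤ ((|s| : ℝ) : EReal) := by
  have h : ∫⁻ y, ENNReal.ofReal (Real.exp (s * y)) ∂muInf
      ≤ ENNReal.ofReal (Real.exp |s|) := by
    calc ∫⁻ y, ENNReal.ofReal (Real.exp (s * y)) ∂muInf
        ≤ ∫⁻ _, ENNReal.ofReal (Real.exp |s|) ∂muInf := by
          refine lintegral_mono_ae ?_
          filter_upwards [ae_muInf_abs_le_one] with y hy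
          refine ENNReal.ofReal_le_ofReal (Real.exp_le_exp.2 ((le_abs_self _).trans ?_))
          rw [abs_mul]
          exact mul_le_of_le_one_right (abs_nonneg s) hy
      _ = ENNReal.ofReal (Real.exp |s|) := by simp
  refine (ENNReal.log_le_log h).trans ?_
  rw [ENNReal.log_ofReal_of_pos (Real.exp_pos _), Real.log_exp]

theorem integral_abs_mul_exp_neg_half_sq :
    ∫ x : ℝ, |x| * Real.exp (-(1 / 2) * |x| ^ (2 : ℝ)) = 2 := by
  rw [integral_comp_abs (f := fun x => x * Real.exp (-(1 / 2) * x ^ (2 : ℝ)))]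
  have h := integral_rpow_mul_exp_neg_mul_rpow (p := 2) (q := 1) (b := 1 / 2)
    (by norm_num) (by norm_num) (by norm_num)
  simp only [Real.rpow_one] at h
  rw [h]
  norm_num [Real.rpow_neg_one]

theorem lintegral_abs_muP_two_le :
    ∫⁻ u, ENNReal.ofReal |u| ∂(muP 2) ≤ ENNReal.ofReal (17 / 20) := by
  have hint : Integrable fun x : ℝ => |x| * Real.exp (-(1 / 2) * |x| ^ (2 : ℝ)) := by
    have h := (integrable_mul_exp_neg_mul_sq (b := 1 / 2) (by norm_num)).abs
    refine h.congr (ae_of_all _ fun x => ?_)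
    simp [abs_mul]
  rw [muP_two, gaussianReal_of_var_ne_zero _ one_ne_zero,
    lintegral_withDensity_eq_lintegral_mul _ (measurable_gaussianPDF 0 1) (by fun_prop)]
  have hpt : ∀ x : ℝ, (gaussianPDF 0 1 * fun u => ENNReal.ofReal |u|) x
      = ENNReal.ofReal ((√(2 * Real.pi))⁻¹ * (|x| * Real.exp (-(1 / 2) * |x| ^ (2 : ℝ)))) := by
    intro x
    rw [Pi.mul_apply, gaussianPDF, ← ENNReal.ofReal_mul (gaussianPDFReal_nonneg _ _ _),
      gaussianPDFReal]
    congr 1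
    rw [Real.rpow_two, sq_abs, NNReal.coe_one, mul_one, mul_one, sub_zero,
      show -(1 / 2) * x ^ 2 = -x ^ 2 / 2 by ring]
    ring
  rw [lintegral_congr hpt, ← ofReal_integral_eq_lintegral_ofReal (hint.const_mul _)
    (ae_of_all _ fun x => by positivity), integral_const_mul, integral_abs_mul_exp_neg_half_sq]
  refine ENNReal.ofReal_le_ofReal ?_
  have hs : (40 / 17 : ℝ) ≤ √(2 * Real.pi) :=
    Real.le_sqrt_of_sq_le (by nlinarith [Real.pi_gt_d2])
  rw [inv_mul_le_iff₀ (by linarith)]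
  linarith

theorem PsiInf_muP_two_le (t : ℝ) : PsiInf (muP 2) t ≤ ((|t| * (17 / 20) : ℝ) : EReal) := by
  have h : ∫⁻ u, erealToENNReal (logM muInf (t * u)) ∂(muP 2)
      ≤ ENNReal.ofReal (|t| * (17 / 20)) := by
    calc ∫⁻ u, erealToENNReal (logM muInf (t * u)) ∂(muP 2)
        ≤ ∫⁻ u, ENNReal.ofReal |t| * ENNReal.ofReal |u| ∂(muP 2) := by
          refine lintegral_mono fun u => ?_
          rw [← ENNReal.ofReal_mul (abs_nonneg t), ← abs_mul]
          refine (EReal.toENNReal_le_toENNReal (logM_muInf_le (t * u))).trans ?_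
          rw [EReal.toENNReal_of_ne_top (EReal.coe_ne_top _), EReal.toReal_coe]
      _ = ENNReal.ofReal |t| * ∫⁻ u, ENNReal.ofReal |u| ∂(muP 2) :=
          lintegral_const_mul _ (by fun_prop)
      _ ≤ ENNReal.ofReal |t| * ENNReal.ofReal (17 / 20) := by
          gcongr
          exact lintegral_abs_muP_two_le
      _ = ENNReal.ofReal (|t| * (17 / 20)) := (ENNReal.ofReal_mul (abs_nonneg t)).symm
  calc PsiInf (muP 2) t
      ≤ ((ENNReal.ofReal (|t| * (17 / 20)) : ℝ≥0∞) : EReal) - 0 :=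
        EReal.sub_le_sub (EReal.coe_ennreal_le_coe_ennreal_iff.2 h) (EReal.coe_ennreal_nonneg _)
    _ = ((|t| * (17 / 20) : ℝ) : EReal) := by
        rw [sub_zero, EReal.coe_ennreal_ofReal, max_eq_left (by positivity)]

theorem IqInf_muP_two_eq_top {w : ℝ} (hw : 9 / 10 ≤ |w|) : IqInf (muP 2) w = ⊤ := by
  refine EReal.eq_top_iff_forall_lt _ |>.2 fun y => ?_
  obtain ⟨s, hs, hsw⟩ : ∃ s : ℝ, |s| = 1 ∧ s * w = |w| := by
    rcases abs_cases w with ⟨h, -⟩ | ⟨h, -⟩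
    · exact ⟨1, by simp, by rw [h, one_mul]⟩
    · exact ⟨-1, by simp, by rw [h]; ring⟩
  set r : ℝ := 20 * (|y| + 1)
  have hr : 0 < r := by positivity
  have hle : ((r * s * w : ℝ) : EReal) - ((|r * s| * (17 / 20) : ℝ) : EReal) ≤ IqInf (muP 2) w :=
    (EReal.sub_le_sub le_rfl (PsiInf_muP_two_le (r * s))).trans
      (le_iSup (fun t : ℝ => ((t * w : ℝ) : EReal) - PsiInf (muP 2) t) (r * s))
  refine lt_of_lt_of_le ?_ hle
  rw [← EReal.coe_sub, EReal.coe_lt_coe_iff, abs_mul, hs, abs_of_pos hr, mul_assoc, hsw]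
  nlinarith [le_abs_self y]

theorem relEnt_self (μ : Measure ℝ) [SigmaFinite μ] : relEnt μ μ = 0 := by
  rw [relEnt, if_pos Measure.AbsolutelyContinuous.rfl, eIntegral]
  have h₁ : ∫⁻ u, erealToENNReal (ENNReal.log (μ.rnDeriv μ u)) ∂μ = 0 := by
    rw [lintegral_eq_zero_of_ae_eq_zero]
    filter_upwards [μ.rnDeriv_self] with u hu
    simp [hu, erealToENNReal]
  have h₂ : ∫⁻ u, erealToENNReal (-ENNReal.log (μ.rnDeriv μ u)) ∂μ = 0 := by
    rw [lintegral_eq_zero_of_ae_eq_zero]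
    filter_upwards [μ.rnDeriv_self] with u hu
    simp [hu, erealToENNReal]
  rw [h₁, h₂]
  simp

theorem exists_sub_Phig_muInf_le {w σ₀ σ₁ z x : ℝ} (hx : |x| < 1) (hz : 0 < σ₀ * (z ^ 2 - 1))
    (hzx : 0 < σ₁ * (z * x - w)) :
    ∃ c : ℝ, ∀ t : ℝ × ℝ, 0 ≤ σ₀ * t.1 → 0 ≤ σ₁ * t.2 →
      ((t.1 * 1 + t.2 * w : ℝ) : EReal) - Phig muInf t ≤ c := by
  have hopen : IsOpen {q : ℝ × ℝ | 0 < σ₀ * (q.2 ^ 2 - 1) ∧ 0 < σ₁ * (q.2 * q.1 - w)} :=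
    (isOpen_lt (f := fun _ : ℝ × ℝ => (0 : ℝ)) (g := fun q => σ₀ * (q.2 ^ 2 - 1))
      (by fun_prop) (by fun_prop)).inter
      (isOpen_lt (f := fun _ : ℝ × ℝ => (0 : ℝ)) (g := fun q => σ₁ * (q.2 * q.1 - w))
        (by fun_prop) (by fun_prop))
  obtain ⟨U, V, hU, hV, hxU, hzV, hUV⟩ := isOpen_prod_iff.1 hopen x z ⟨hz, hzx⟩
  set m : ℝ≥0∞ := muInf U * muP 2 V with hm
  have hm0 : m ≠ 0 := mul_ne_zero (muInf_pos_of_isOpen hU hxU hx).ne'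
    (hV.measure_pos (muP 2) ⟨z, hzV⟩).ne'
  have hmtop : m ≠ ⊤ := ENNReal.mul_ne_top (measure_ne_top _ _) (measure_ne_top _ _)
  have key : ∀ t : ℝ × ℝ, 0 ≤ σ₀ * t.1 → 0 ≤ σ₁ * t.2 →
      ENNReal.ofReal (Real.exp (t.1 * 1 + t.2 * w)) * m ≤
        ∫⁻ x, (∫⁻ z, ENNReal.ofReal (Real.exp (t.1 * z ^ 2 + t.2 * z * x)) ∂(muP 2)) ∂muInf := by
    intro t ht₀ ht₁
    set e : ℝ≥0∞ := ENNReal.ofReal (Real.exp (t.1 * 1 + t.2 * w))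
    calc e * m = ∫⁻ _ in U, (∫⁻ _ in V, e ∂(muP 2)) ∂muInf := by
          rw [setLIntegral_const, setLIntegral_const, hm]
          ring
      _ ≤ ∫⁻ x in U, (∫⁻ z, ENNReal.ofReal (Real.exp (t.1 * z ^ 2 + t.2 * z * x)) ∂(muP 2))
            ∂muInf := by
          refine setLIntegral_mono' hU.measurableSet fun x' hx' => ?_
          refine (setLIntegral_mono' hV.measurableSet fun z' hz' => ?_).trans
            (setLIntegral_le_lintegral V _)
          obtain ⟨h₀, h₁⟩ := hUV (mk_mem_prod hx' hz')
          have sign {σ a b : ℝ} (ha : 0 ≤ σ * a) (hb : 0 < σ * b) : 0 ≤ a * b := by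
            have hσ : σ ≠ 0 := left_ne_zero_of_mul hb.ne'
            have hp : 0 ≤ σ ^ 2 * (a * b) := by nlinarith [mul_nonneg ha hb.le]
            exact nonneg_of_mul_nonneg_right hp (by positivity)
          refine ENNReal.ofReal_le_ofReal (Real.exp_le_exp.2 ?_)
          nlinarith [sign ht₀ h₀, sign ht₁ h₁]
      _ ≤ _ := setLIntegral_le_lintegral U _
  refine ⟨-Real.log m.toReal, fun t ht₀ ht₁ => ?_⟩
  have h := ENNReal.log_le_log (key t ht₀ ht₁)
  rw [ENNReal.log_mul_add, ENNReal.log_ofReal_of_pos (Real.exp_pos _), Real.log_exp,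
    ENNReal.log_pos_real hm0 hmtop, ← EReal.coe_add] at h
  refine (EReal.sub_le_sub le_rfl h).trans ?_
  rw [← EReal.coe_sub, EReal.coe_le_coe_iff]
  linarith

theorem exists_point_in_quadrant {w : ℝ} (hw : |w| < 1) {σ₀ σ₁ : ℝ}
    (h₀ : σ₀ = 1 ∨ σ₀ = -1) (h₁ : σ₁ = 1 ∨ σ₁ = -1) :
    ∃ z x : ℝ, |x| < 1 ∧ 0 < σ₀ * (z ^ 2 - 1) ∧ 0 < σ₁ * (z * x - w) := by
  obtain ⟨z, hwz, hz⟩ : ∃ z : ℝ, |w| < z ∧ 0 < σ₀ * (z ^ 2 - 1) := by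
    rcases h₀ with rfl | rfl
    · exact ⟨2, by linarith, by norm_num⟩
    · exact ⟨(1 + |w|) / 2, by linarith, by nlinarith [abs_nonneg w]⟩
  have hz0 : 0 < z := (abs_nonneg w).trans_lt hwz
  have hq : |w / z| < 1 := by rwa [abs_div, abs_of_pos hz0, div_lt_one hz0]
  obtain ⟨hq₁, hq₂⟩ := abs_lt.1 hq
  have hzw : z * (w / z) = w := by field_simp
  refine ⟨z, (w / z + σ₁) / 2, abs_lt.2 ?_, hz, ?_⟩
  · rcases h₁ with rfl | rfl <;> constructor <;> linarith
  · rcases h₁ with rfl | rfl <;> nlinarith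

theorem IaInf_lt_top {w : ℝ} (hw : |w| < 1) : IaInf w < ⊤ := by
  have hc : ∀ σ₀ σ₁ : ℝ, σ₀ = 1 ∨ σ₀ = -1 → σ₁ = 1 ∨ σ₁ = -1 →
      ∃ c : ℝ, ∀ t : ℝ × ℝ, 0 ≤ σ₀ * t.1 → 0 ≤ σ₁ * t.2 →
        ((t.1 * 1 + t.2 * w : ℝ) : EReal) - Phig muInf t ≤ c := by
    intro σ₀ σ₁ h₀ h₁
    obtain ⟨z, x, hx, hz, hzx⟩ := exists_point_in_quadrant hw h₀ h₁
    exact exists_sub_Phig_muInf_le hx hz hzx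
  obtain ⟨a, ha⟩ := hc 1 1 (.inl rfl) (.inl rfl)
  obtain ⟨b, hb⟩ := hc 1 (-1) (.inl rfl) (.inr rfl)
  obtain ⟨c, hc'⟩ := hc (-1) 1 (.inr rfl) (.inl rfl)
  obtain ⟨d, hd⟩ := hc (-1) (-1) (.inr rfl) (.inr rfl)
  have hle : IaInf w ≤ legendre2 (Phig muInf) (1, w) :=
    iInf₂_le (1, w) ⟨one_pos, by simp⟩
  refine (hle.trans (iSup_le fun t => ?_)).trans_lt
    (EReal.coe_lt_top (max (max a b) (max c d)))
  rcases le_total 0 t.1 with h₀ | h₀ <;> rcases le_total 0 t.2 with h₁ | h₁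
  · exact (ha t (by linarith) (by linarith)).trans (EReal.coe_le_coe (by simp))
  · exact (hb t (by linarith) (by linarith)).trans (EReal.coe_le_coe (by simp))
  · exact (hc' t (by linarith) (by linarith)).trans (EReal.coe_le_coe (by simp))
  · exact (hd t (by linarith) (by linarith)).trans (EReal.coe_le_coe (by simp))

end LDP

/-- For `p = ∞`, the Gaussian does not attain the infimum in the variational
formula for `|w|` close to 1, and the annealed rate lies strictly below the quenched rate. -/
theorem statement9 :
    ∃ wstar ∈ Set.Ioo (0:ℝ) 1, ∀ w : ℝ, wstar ≤ |w| → |w| < 1 →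
      (IaInf w < IqInf (muP 2) w + relEnt (muP 2) (muP 2)
          + (((1 - (mom 2 (muP 2)).toReal) / 2 : ℝ) : EReal))
      ∧ IaInf w < IqInf (muP 2) w := by
  refine ⟨9 / 10, ⟨by norm_num, by norm_num⟩, fun w hw hw1 => ?_⟩
  rw [IqInf_muP_two_eq_top hw, relEnt_self, add_zero, EReal.top_add_coe]
  exact ⟨IaInf_lt_top hw1, IaInf_lt_top hw1⟩
end
end
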